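/- arXiv:1407.5840 — 2 statements merged into one kernel-verified Lean document; each statement's English description precedes it below -/
import Mathlib

section
/- Let d ≥ 2 and R > 0. Let (X_ε(x))_{ε∈(0,1], x∈ℝ^d} be a centered Gaussian process on a probability space (Ω, P) such that: (A) there is a constant C > 0 with E[(X_ε(x) − X_η(y))²] ≤ C·(‖x−y‖ + |η−ε|)/(min(η,ε)) for all x, y in the ball B(0,R) and all ε, η ∈ (0,1]; and (B) the variance G(ε) := E[X_ε(x)²] does not depend on x and satisfies G(ε)/log(1/ε) → 1 as ε → 0+. Then there exists a modification X̃ of the process which is jointly continuous in (ε, x) on (0,1] × B(0,R) such that for every a with 0 ≤ a ≤ √(2d), almost surely the Hausdorff dimension of the set T_≥(a,R) := {x ∈ B(0,R) : lim_{ε→0+} X̃_ε(x)/G(ε) exists and is ≥ a} is at most d − a²/2. -/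
open MeasureTheory ProbabilityTheory Filter

noncomputable section

/-- A family `(X_i)_{i ∈ I}` of real random variables is a centered Gaussian process if
every finite real linear combination has a centered (possibly degenerate) Gaussian law. -/
def IsCenteredGaussianProcess {Ω : Type*} [MeasurableSpace Ω] (P : Measure Ω)
    {I : Type*} (X : I → Ω → ℝ) : Prop :=
  ∀ (n : ℕ) (c : Fin n → ℝ) (idx : Fin n → I), ∃ v : NNReal,
    Measure.map (fun ω => ∑ j, c j * X (idx j) ω) P = gaussianReal 0 v

lemma tp_gauss_tail {Ω : Type*} [MeasurableSpace Ω] (P : Measure Ω) [IsProbabilityMeasure P]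
    (Z : Ω → ℝ) (v : NNReal) (hZ : Measure.map Z P = gaussianReal 0 v)
    (V t : ℝ) (hV : 0 < V) (hvar : ∫ ω, (Z ω) ^ 2 ∂P ≤ V) (ht : 0 ≤ t) :
    P {ω | t ≤ Z ω} ≤ ENNReal.ofReal (Real.exp (-(t ^ 2 / (2 * V)))) := by
  have hm : AEMeasurable Z P := by
    apply AEMeasurable.of_map_ne_zero
    rw [hZ]; exact IsProbabilityMeasure.ne_zero _
  have hv : (v : ℝ) ≤ V := by
    have h1 : ∫ ω, (Z ω) ^ 2 ∂P = ∫ x, x ^ 2 ∂(gaussianReal 0 v) := by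
      rw [← hZ, integral_map hm (by fun_prop)]
    have h2 := variance_id_gaussianReal (μ := 0) (v := v)
    rw [variance_eq_integral (by fun_prop)] at h2
    simp at h2
    rw [← h2, ← h1]; exact hvar
  have hint : Integrable (fun ω => Real.exp (t / V * Z ω)) P := by
    have := integrable_exp_mul_gaussianReal (μ := 0) (v := v) (t / V)
    rw [← hZ] at this
    exact (integrable_map_measure (by fun_prop) hm).1 this
  have h := measure_ge_le_exp_mul_mgf (X := Z) (μ := P) t (div_nonneg ht hV.le) hint
  rw [mgf_gaussianReal hZ] at h
  have h3 : P {ω | t ≤ Z ω} = ENNReal.ofReal (P.real {ω | t ≤ Z ω}) := by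
    simp [Measure.real]
  rw [h3]
  apply ENNReal.ofReal_le_ofReal
  refine h.trans ?_
  rw [← Real.exp_add]
  apply Real.exp_le_exp.2
  have : (v : ℝ) * (t / V) ^ 2 / 2 ≤ V * (t / V) ^ 2 / 2 := by gcongr
  have e1 : V * (t / V) ^ 2 / 2 = t ^ 2 / (2 * V) := by field_simp
  have e2 : -(t / V) * t = - (2 * (t ^ 2 / (2 * V))) := by field_simp
  linarith

lemma tp_gauss_tail_abs {Ω : Type*} [MeasurableSpace Ω] (P : Measure Ω) [IsProbabilityMeasure P]
    (Z : Ω → ℝ) (v : NNReal) (hZ : Measure.map Z P = gaussianReal 0 v)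
    (V t : ℝ) (hV : 0 < V) (hvar : ∫ ω, (Z ω) ^ 2 ∂P ≤ V) (ht : 0 ≤ t) :
    P {ω | t ≤ |Z ω|} ≤ ENNReal.ofReal (2 * Real.exp (-(t ^ 2 / (2 * V)))) := by
  have hm : AEMeasurable Z P := by
    apply AEMeasurable.of_map_ne_zero
    rw [hZ]; exact IsProbabilityMeasure.ne_zero _
  have hZ' : Measure.map (fun ω => - Z ω) P = gaussianReal 0 v := by
    have : Measure.map (fun x => - x) (Measure.map Z P) = Measure.map (fun ω => - Z ω) P :=
      AEMeasurable.map_map_of_aemeasurable (by fun_prop) hm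
    rw [← this, hZ, gaussianReal_map_neg, neg_zero]
  have h1 := tp_gauss_tail P Z v hZ V t hV hvar ht
  have h2 := tp_gauss_tail P _ v hZ' V t hV (by simpa using hvar) ht
  have : {ω | t ≤ |Z ω|} ⊆ {ω | t ≤ Z ω} ∪ {ω | t ≤ - Z ω} := by
    intro ω h; simpa [le_abs] using h
  refine (measure_mono this).trans ((measure_union_le _ _).trans ?_)
  rw [two_mul, ENNReal.ofReal_add (Real.exp_nonneg _) (Real.exp_nonneg _)]
  exact add_le_add h1 h2

/-- super-exponential decay beats exponentials -/
lemma tp_superexp (c A q : ℝ) (hc : 0 < c) (hA : 0 < A) (hq : 1 < q) :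
    ∃ M : ℝ, 0 ≤ M ∧ ∀ j : ℕ, A ^ j * Real.exp (-(c * q ^ j)) ≤ M * (1 / 2) ^ j := by
  obtain ⟨p, hp⟩ := pow_unbounded_of_one_lt (2 * A) hq
  refine ⟨p.factorial / c ^ p, by positivity, fun j => ?_⟩
  have hq0 : 0 < q := by linarith
  have h := Real.pow_div_factorial_le_exp (c * q ^ j) (by positivity) p
  rw [Real.exp_neg]
  have h1 : (Real.exp (c * q ^ j))⁻¹ ≤ ((c * q ^ j) ^ p / p.factorial)⁻¹ :=
    inv_anti₀ (by positivity) h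
  have h2 : (2 * A) ^ j ≤ (q ^ p) ^ j := by gcongr
  calc A ^ j * (Real.exp (c * q ^ j))⁻¹ ≤ A ^ j * ((c * q ^ j) ^ p / p.factorial)⁻¹ := by gcongr
    _ = p.factorial / c ^ p * (A ^ j / (q ^ p) ^ j) := by
        rw [mul_pow, ← pow_mul, ← pow_mul, mul_comm j p]; field_simp
    _ ≤ p.factorial / c ^ p * (1 / 2) ^ j := by
        gcongr
        rw [div_le_iff₀ (by positivity)]
        calc A ^ j = (1/2) ^ j * (2 * A) ^ j := by rw [← mul_pow]; congr 1; ring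
          _ ≤ _ := by gcongr

/-- truncation towards zero -/
noncomputable def tpTrunc (y : ℝ) : ℤ := if 0 ≤ y then ⌊y⌋ else ⌈y⌉

lemma tpTrunc_abs (y : ℝ) : |(tpTrunc y : ℝ)| ≤ |y| := by
  unfold tpTrunc
  split_ifs with h
  · have : (0:ℝ) ≤ (⌊y⌋ : ℝ) := by exact_mod_cast Int.floor_nonneg.2 h
    rw [abs_of_nonneg this, abs_of_nonneg h]; exact Int.floor_le y
  · push Not at h
    have : (⌈y⌉ : ℝ) ≤ 0 := by exact_mod_cast Int.ceil_le.2 (by simpa using h.le)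
    rw [abs_of_nonpos this, abs_of_neg h]; linarith [Int.le_ceil y]

lemma tpTrunc_sub (y : ℝ) : |(tpTrunc y : ℝ) - y| ≤ 1 := by
  unfold tpTrunc
  rw [abs_le]
  split_ifs with h
  · constructor <;> linarith [Int.floor_le y, Int.lt_floor_add_one y]
  · constructor <;> linarith [Int.le_ceil y, Int.ceil_lt_add_one y]

noncomputable def tpSig {d : ℕ} (m : ℕ) (x : EuclideanSpace ℝ (Fin d)) : EuclideanSpace ℝ (Fin d) :=
  WithLp.toLp 2 (fun i => (tpTrunc (2 ^ m * x i) : ℝ) / 2 ^ m)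

lemma tpSig_norm {d : ℕ} (m : ℕ) (x : EuclideanSpace ℝ (Fin d)) : ‖tpSig m x‖ ≤ ‖x‖ := by
  rw [EuclideanSpace.norm_eq, EuclideanSpace.norm_eq]
  apply Real.sqrt_le_sqrt
  apply Finset.sum_le_sum
  intro i _
  have : ‖tpSig m x i‖ ≤ ‖x i‖ := by
    simp only [tpSig, Real.norm_eq_abs, abs_div]
    rw [div_le_iff₀ (by positivity)]
    have := tpTrunc_abs (2 ^ m * x i)
    rw [abs_mul] at this
    linarith
  gcongr

lemma tp_norm_le_sum {d : ℕ} (x : EuclideanSpace ℝ (Fin d)) (c : ℝ) (hc : 0 ≤ c)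
    (h : ∀ i, |x i| ≤ c) : ‖x‖ ≤ d * c := by
  rw [EuclideanSpace.norm_eq]
  apply Real.sqrt_le_iff.2
  refine ⟨by positivity, ?_⟩
  calc ∑ i, ‖x i‖ ^ 2 ≤ ∑ i : Fin d, c ^ 2 := by
        apply Finset.sum_le_sum; intro i _
        have := h i
        rw [Real.norm_eq_abs]; gcongr
    _ = d * c ^ 2 := by simp
    _ ≤ (d * c) ^ 2 := by
        rcases Nat.eq_zero_or_pos d with h0 | h0
        · simp [h0]
        · have : (1:ℝ) ≤ d := by exact_mod_cast h0
          rw [mul_pow]; gcongr; nlinarith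

lemma tpSig_sub {d : ℕ} (m : ℕ) (x : EuclideanSpace ℝ (Fin d)) :
    ‖tpSig m x - x‖ ≤ d * (1 / 2) ^ m := by
  apply tp_norm_le_sum _ _ (by positivity)
  intro i
  have := tpTrunc_sub (2 ^ m * x i)
  have e : (tpSig m x - x) i = ((tpTrunc (2 ^ m * x i) : ℝ) - 2 ^ m * x i) * (1 / 2) ^ m := by
    simp only [tpSig, PiLp.sub_apply]
    rw [one_div, inv_pow]; field_simp
  rw [e, abs_mul, abs_of_nonneg (by positivity : (0:ℝ) ≤ (1/2)^m)]
  have h0 : (0:ℝ) ≤ (1/2)^m := by positivity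
  nlinarith

lemma tpSig_finset (d : ℕ) (R : ℝ) (hR : 0 < R) : ∃ K : ℝ, 0 < K ∧ ∀ m : ℕ,
    ∃ S : Finset (EuclideanSpace ℝ (Fin d)), (S.card : ℝ) ≤ K * ((2:ℝ) ^ d) ^ m ∧
      (∀ x ∈ S, x ∈ Metric.ball (0 : EuclideanSpace ℝ (Fin d)) R) ∧
      ∀ x ∈ Metric.ball (0 : EuclideanSpace ℝ (Fin d)) R, tpSig m x ∈ S := by
  classical
  refine ⟨(2 * R + 1) ^ d, by positivity, fun m => ?_⟩
  set N : ℤ := ⌊R * 2 ^ m⌋ with hN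
  have hN0 : 0 ≤ N := Int.floor_nonneg.2 (by positivity)
  let T : Finset (Fin d → ℤ) := Fintype.piFinset (fun _ => Finset.Icc (-N) N)
  let f : (Fin d → ℤ) → EuclideanSpace ℝ (Fin d) :=
    fun z => WithLp.toLp 2 (fun i => (z i : ℝ) / 2 ^ m)
  refine ⟨(T.image f).filter (fun x => x ∈ Metric.ball 0 R), ?_, ?_, ?_⟩
  · have h1 : (((T.image f).filter (fun x => x ∈ Metric.ball 0 R)).card : ℝ) ≤ (T.card : ℝ) := by
      exact_mod_cast (Finset.card_filter_le _ _).trans Finset.card_image_le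
    refine h1.trans ?_
    have h2 : (T.card : ℝ) = ((2 * N + 1 : ℤ) : ℝ) ^ d := by
      have : (((Finset.Icc (-N) N).card : ℕ) : ℤ) = 2 * N + 1 := by
        rw [Int.card_Icc]; omega
      simp only [T, Fintype.card_piFinset, Finset.prod_const, Finset.card_univ, Fintype.card_fin]
      rw [← this]; push_cast; rfl
    rw [h2, ← pow_mul, mul_comm d m, pow_mul, ← mul_pow]
    have h3 : (N : ℝ) ≤ R * 2 ^ m := Int.floor_le _
    have h4 : (1:ℝ) ≤ 2 ^ m := one_le_pow₀ (by norm_num)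
    have h5 : (0:ℝ) ≤ N := by exact_mod_cast hN0
    push_cast
    gcongr
    nlinarith
  · intro x hx
    exact (Finset.mem_filter.1 hx).2
  · intro x hx
    rw [Finset.mem_filter]
    constructor
    · rw [Finset.mem_image]
      refine ⟨fun i => tpTrunc (2 ^ m * x i), ?_, rfl⟩
      simp only [T, Fintype.mem_piFinset, Finset.mem_Icc]
      intro i
      rw [← abs_le, hN, Int.le_floor]
      have := tpTrunc_abs (2 ^ m * x i)
      rw [Int.cast_abs]
      refine this.trans ?_
      rw [abs_mul, abs_of_nonneg (by positivity : (0:ℝ) ≤ 2 ^ m), mul_comm]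
      have h1 : |x i| ≤ ‖x‖ := by
        have := PiLp.norm_apply_le x i
        simpa using this
      have h2 : ‖x‖ < R := by simpa using hx
      gcongr; linarith
    · have h2 : ‖x‖ < R := by simpa using hx
      simpa using (tpSig_norm m x).trans_lt h2

noncomputable def tpTau (m : ℕ) (e : ℝ) : ℝ := (⌈(2:ℝ) ^ m * e⌉₊ : ℝ) / 2 ^ m

lemma tpTau_ge (m : ℕ) (e : ℝ) : e ≤ tpTau m e := by
  unfold tpTau
  rw [le_div_iff₀ (by positivity), mul_comm]
  exact Nat.le_ceil _

lemma tpTau_le_one (m : ℕ) (e : ℝ) (he : e ≤ 1) : tpTau m e ≤ 1 := by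
  unfold tpTau
  rw [div_le_one (by positivity)]
  have : ⌈(2:ℝ) ^ m * e⌉₊ ≤ 2 ^ m := by
    apply Nat.ceil_le.2
    have : (0:ℝ) < 2 ^ m := by positivity
    push_cast; nlinarith
  exact_mod_cast this

lemma tpTau_sub (m : ℕ) (e : ℝ) (he : 0 ≤ e) : |tpTau m e - e| ≤ (1 / 2) ^ m := by
  rw [abs_of_nonneg (by linarith [tpTau_ge m e])]
  have := (Nat.ceil_lt_add_one (a := (2:ℝ) ^ m * e) (by positivity)).le
  unfold tpTau
  have e1 : (⌈(2:ℝ) ^ m * e⌉₊ : ℝ) / 2 ^ m - e = (⌈(2:ℝ) ^ m * e⌉₊ - 2 ^ m * e) * (1 / 2) ^ m := by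
    rw [one_div, inv_pow]; field_simp
  rw [e1]
  have h0 : (0:ℝ) ≤ (1/2)^m := by positivity
  nlinarith

lemma tpTau_dyadic (n j : ℕ) : tpTau (n + j) ((1 / 2) ^ n) = (1 / 2) ^ n := by
  unfold tpTau
  have : (2:ℝ) ^ (n + j) * (1 / 2) ^ n = ((2 ^ j : ℕ) : ℝ) := by
    rw [pow_add, one_div, inv_pow]; push_cast; field_simp
  rw [this, Nat.ceil_natCast, pow_add, one_div, inv_pow]; push_cast; field_simp

lemma tpTau_finset (m : ℕ) : ∃ S : Finset ℝ, (S.card : ℝ) ≤ 2 ^ m ∧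
    (∀ e ∈ S, e ∈ Set.Ioc (0:ℝ) 1) ∧ ∀ e ∈ Set.Ioc (0:ℝ) 1, tpTau m e ∈ S := by
  classical
  refine ⟨(Finset.Icc 1 (2 ^ m)).image (fun k : ℕ => (k : ℝ) / 2 ^ m), ?_, ?_, ?_⟩
  · have := Finset.card_image_le (s := Finset.Icc 1 (2 ^ m)) (f := fun k : ℕ => (k : ℝ) / 2 ^ m)
    rw [Nat.card_Icc] at this
    exact_mod_cast this
  · intro e he
    obtain ⟨k, hk, rfl⟩ := Finset.mem_image.1 he
    rw [Finset.mem_Icc] at hk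
    have h1 : (1:ℝ) ≤ k := by exact_mod_cast hk.1
    have h2 : (k:ℝ) ≤ 2 ^ m := by exact_mod_cast hk.2
    constructor
    · positivity
    · rw [div_le_one (by positivity)]; exact h2
  · intro e he
    apply Finset.mem_image.2
    refine ⟨⌈(2:ℝ) ^ m * e⌉₊, ?_, rfl⟩
    rw [Finset.mem_Icc]
    constructor
    · have : 0 < ⌈(2:ℝ) ^ m * e⌉₊ := Nat.ceil_pos.2 (by have := he.1; positivity)
      omega
    · apply Nat.ceil_le.2
      have : (0:ℝ) < 2 ^ m := by positivity
      have := he.2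
      push_cast; nlinarith

noncomputable def tpPi {d : ℕ} (m : ℕ) (p : ℝ × EuclideanSpace ℝ (Fin d)) :
    ℝ × EuclideanSpace ℝ (Fin d) := (tpTau m p.1, tpSig m p.2)

def tpD (d : ℕ) (R : ℝ) : Set (ℝ × EuclideanSpace ℝ (Fin d)) :=
  Set.Ioc (0:ℝ) 1 ×ˢ Metric.ball 0 R

lemma tpPi_mem {d : ℕ} {R : ℝ} (m : ℕ) {p : ℝ × EuclideanSpace ℝ (Fin d)} (hp : p ∈ tpD d R) :
    tpPi m p ∈ tpD d R := by
  obtain ⟨h1, h2⟩ := hp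
  refine ⟨⟨h1.1.trans_le (tpTau_ge m _), tpTau_le_one m _ h1.2⟩, ?_⟩
  have h3 : ‖p.2‖ < R := by simpa using h2
  simpa [tpPi] using (tpSig_norm m p.2).trans_lt h3

/-- Borel-Cantelli for the tails -/
lemma tp_bc {Ω : Type*} [MeasurableSpace Ω] (P : Measure Ω)
    (s : ℕ → Set Ω) (M : ℝ) (hs : ∀ j, P (s j) ≤ ENNReal.ofReal (M * (1 / 2) ^ j)) :
    ∀ᵐ ω ∂P, ∀ᶠ j in atTop, ω ∉ s j := by
  apply ae_eventually_notMem
  have h1 : Summable (fun j : ℕ => M * (1 / 2 : ℝ) ^ j) := summable_geometric_two.mul_left M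
  exact ne_top_of_le_ne_top h1.tsum_ofReal_ne_top (ENNReal.tsum_le_tsum hs)

lemma tp_good {d : ℕ} {R : ℝ} {Ω : Type*} [MeasurableSpace Ω] (P : Measure Ω)
    (Y : ℝ × EuclideanSpace ℝ (Fin d) → Ω → ℝ) (C : ℝ) (hC : 0 < C)
    (hT : ∀ p ∈ tpD d R, ∀ q ∈ tpD d R, ∀ V > 0,
      C * (‖p.2 - q.2‖ + |q.1 - p.1|) / min q.1 p.1 ≤ V → ∀ t : ℝ, 0 ≤ t →
      P {ω | t ≤ |Y p ω - Y q ω|} ≤ ENNReal.ofReal (2 * Real.exp (-(t ^ 2 / (2 * V)))))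
    (S : ℕ → Finset (ℝ × EuclideanSpace ℝ (Fin d))) (hSD : ∀ m, ∀ p ∈ S m, p ∈ tpD d R)
    (K B L : ℝ) (hK : 0 < K) (hB : 1 ≤ B) (hL : 0 < L)
    (hcard : ∀ m, ((S m).card : ℝ) ≤ K * B ^ m) (k : ℕ) :
    ∀ᵐ ω ∂P, ∀ᶠ j in atTop, ∀ n ≤ k * j, ∀ u ∈ S (n + j), ∀ v ∈ S (n + j),
      (1 / 2 : ℝ) ^ n ≤ u.1 → (1 / 2 : ℝ) ^ n ≤ v.1 →
      ‖u.2 - v.2‖ + |v.1 - u.1| ≤ L * (1 / 2) ^ (n + j) →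
      |Y u ω - Y v ω| ≤ (3 / 4 : ℝ) ^ j := by
  classical
  let Q : ℕ → ℕ → Finset ((ℝ × EuclideanSpace ℝ (Fin d)) × (ℝ × EuclideanSpace ℝ (Fin d))) :=
    fun n j => (S (n + j) ×ˢ S (n + j)).filter (fun q => (1 / 2 : ℝ) ^ n ≤ q.1.1 ∧
      (1 / 2 : ℝ) ^ n ≤ q.2.1 ∧ ‖q.1.2 - q.2.2‖ + |q.2.1 - q.1.1| ≤ L * (1 / 2) ^ (n + j))
  let s : ℕ → Set Ω := fun j => ⋃ n ∈ Finset.range (k * j + 1), ⋃ q ∈ Q n j,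
    {ω | (3 / 4 : ℝ) ^ j ≤ |Y q.1 ω - Y q.2 ω|}
  have hB0 : 0 < B := by linarith
  set c : ℝ := 1 / (2 * (C * L)) with hc
  have hc0 : 0 < c := by positivity
  set A : ℝ := 2 * (B ^ (k + 1)) ^ 2 with hA
  obtain ⟨M, hM0, hM⟩ := tp_superexp c A (9 / 8) hc0 (by positivity) (by norm_num)
  have key : ∀ j, P (s j) ≤ ENNReal.ofReal ((2 * (k + 1) * K ^ 2 * M) * (1 / 2) ^ j) := by
    intro j
    have h1 : ∀ n ∈ Finset.range (k * j + 1), P (⋃ q ∈ Q n j,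
        {ω | (3 / 4 : ℝ) ^ j ≤ |Y q.1 ω - Y q.2 ω|}) ≤
        ENNReal.ofReal ((K * (B ^ (k + 1)) ^ j) ^ 2 * (2 * Real.exp (-(c * (9 / 8) ^ j)))) := by
      intro n hn
      have hn' : n + j ≤ (k + 1) * j := by
        have := Finset.mem_range.1 hn
        nlinarith
      have h2 : ∀ q ∈ Q n j, P {ω | (3 / 4 : ℝ) ^ j ≤ |Y q.1 ω - Y q.2 ω|} ≤
          ENNReal.ofReal (2 * Real.exp (-(c * (9 / 8) ^ j))) := by
        intro q hq
        simp only [Q, Finset.mem_filter, Finset.mem_product] at hq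
        obtain ⟨⟨hq1, hq2⟩, hu, hv, hd⟩ := hq
        have h3 := hT q.1 (hSD _ _ hq1) q.2 (hSD _ _ hq2) (C * L * (1 / 2) ^ j) (by positivity) (by
          have hmin : (1 / 2 : ℝ) ^ n ≤ min q.2.1 q.1.1 := le_min hv hu
          have hp : (0:ℝ) < (1 / 2) ^ n := by positivity
          rw [div_le_iff₀ (hp.trans_le hmin)]
          calc C * (‖q.1.2 - q.2.2‖ + |q.2.1 - q.1.1|) ≤ C * (L * (1 / 2) ^ (n + j)) := by gcongr
            _ = C * L * (1 / 2) ^ j * (1 / 2) ^ n := by rw [pow_add]; ring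
            _ ≤ _ := by gcongr) ((3 / 4) ^ j) (by positivity)
        refine h3.trans (le_of_eq ?_)
        congr 4
        rw [hc, ← pow_mul, mul_comm j 2, pow_mul]
        have : ((3 / 4 : ℝ) ^ 2) ^ j = (9 / 8) ^ j * (1 / 2) ^ j := by
          rw [← mul_pow]; norm_num
        rw [this]
        field_simp
      calc _ ≤ ∑ q ∈ Q n j, P {ω | (3 / 4 : ℝ) ^ j ≤ |Y q.1 ω - Y q.2 ω|} :=
            measure_biUnion_finset_le _ _
        _ ≤ ∑ q ∈ Q n j, ENNReal.ofReal (2 * Real.exp (-(c * (9 / 8) ^ j))) :=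
            Finset.sum_le_sum h2
        _ = ENNReal.ofReal (((Q n j).card : ℝ) * (2 * Real.exp (-(c * (9 / 8) ^ j)))) := by
            rw [Finset.sum_const, nsmul_eq_mul, ENNReal.ofReal_mul (by positivity)]
            simp
        _ ≤ _ := by
            apply ENNReal.ofReal_le_ofReal
            gcongr
            have h4 : ((Q n j).card : ℝ) ≤ ((S (n + j)).card : ℝ) ^ 2 := by
              have := Finset.card_filter_le (S (n + j) ×ˢ S (n + j)) (fun q => (1 / 2 : ℝ) ^ n ≤ q.1.1 ∧
                (1 / 2 : ℝ) ^ n ≤ q.2.1 ∧ ‖q.1.2 - q.2.2‖ + |q.2.1 - q.1.1| ≤ L * (1 / 2) ^ (n + j))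
              rw [Finset.card_product] at this
              rw [sq]; exact_mod_cast this
            refine h4.trans ?_
            have h5 : ((S (n + j)).card : ℝ) ≤ K * (B ^ (k + 1)) ^ j := by
              refine (hcard _).trans ?_
              rw [← pow_mul]
              gcongr
            gcongr
    calc P (s j) ≤ ∑ n ∈ Finset.range (k * j + 1), P (⋃ q ∈ Q n j,
          {ω | (3 / 4 : ℝ) ^ j ≤ |Y q.1 ω - Y q.2 ω|}) := measure_biUnion_finset_le _ _
      _ ≤ _ := Finset.sum_le_sum h1
      _ = ENNReal.ofReal (((k * j + 1 : ℕ) : ℝ) * ((K * (B ^ (k + 1)) ^ j) ^ 2 *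
            (2 * Real.exp (-(c * (9 / 8) ^ j))))) := by
            rw [Finset.sum_const, nsmul_eq_mul,
              ENNReal.ofReal_mul (p := ((k * j + 1 : ℕ) : ℝ)) (by positivity),
              ENNReal.ofReal_natCast, Finset.card_range]
      _ ≤ _ := by
            apply ENNReal.ofReal_le_ofReal
            have h6 : ((k * j + 1 : ℕ) : ℝ) ≤ (k + 1) * 2 ^ j := by
              have : j + 1 ≤ 2 ^ j := Nat.lt_two_pow_self
              have h7 : k * j + 1 ≤ (k + 1) * 2 ^ j := by nlinarith
              exact_mod_cast h7
            calc _ ≤ ((k + 1) * 2 ^ j) * ((K * (B ^ (k + 1)) ^ j) ^ 2 *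
                  (2 * Real.exp (-(c * (9 / 8) ^ j)))) := by gcongr
              _ = (2 * (k + 1) * K ^ 2) * (A ^ j * Real.exp (-(c * (9 / 8) ^ j))) := by
                  rw [hA, mul_pow 2, ← pow_mul _ 2 j, mul_comm 2 j, pow_mul _ j 2]; ring
              _ ≤ (2 * (k + 1) * K ^ 2) * (M * (1 / 2) ^ j) := mul_le_mul_of_nonneg_left (hM j) (by positivity)
              _ = _ := by ring
  filter_upwards [tp_bc P s _ key] with ω hω
  filter_upwards [hω] with j hj n hn u hu v hv h1 h2 h3
  by_contra hcon
  apply hj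
  push Not at hcon
  simp only [s, Set.mem_iUnion]
  refine ⟨n, Finset.mem_range.2 (by omega), (u, v), ?_, ?_⟩
  · simp only [Q, Finset.mem_filter, Finset.mem_product]
    exact ⟨⟨hu, hv⟩, h1, h2, h3⟩
  · simpa using hcon.le

/-- finite grids -/
lemma tp_grid (d : ℕ) (R : ℝ) (hR : 0 < R) : ∃ (S : ℕ → Finset (ℝ × EuclideanSpace ℝ (Fin d)))
    (K B : ℝ), 0 < K ∧ 1 ≤ B ∧ (∀ m, ((S m).card : ℝ) ≤ K * B ^ m) ∧
    (∀ m, ∀ p ∈ S m, p ∈ tpD d R) ∧ (∀ m, ∀ p ∈ tpD d R, tpPi m p ∈ S m) ∧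
    (∀ m, ∀ p ∈ tpD d R, tpPi (m + 1) p ∈ S m) := by
  classical
  obtain ⟨K, hK, hS⟩ := tpSig_finset d R hR
  choose S hSc hSb hSm using hS
  choose T hTc hTb hTm using tpTau_finset
  have hc : ∀ m, (((T m) ×ˢ (S m)).card : ℝ) ≤ K * (2 ^ (d + 1)) ^ m := by
    intro m
    rw [Finset.card_product]; push_cast
    calc _ ≤ (2:ℝ) ^ m * (K * (2 ^ d) ^ m) := by gcongr; exact hTc m; exact hSc m
      _ = _ := by rw [pow_succ (2:ℝ) d, mul_pow]; ring
  refine ⟨fun m => (T m ×ˢ S m) ∪ (T (m + 1) ×ˢ S (m + 1)), K * (1 + 2 ^ (d + 1)), 2 ^ (d + 1),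
    by positivity, one_le_pow₀ (by norm_num), ?_, ?_, ?_, ?_⟩
  · intro m
    have := Finset.card_union_le (T m ×ˢ S m) (T (m + 1) ×ˢ S (m + 1))
    have h1 : (((T m ×ˢ S m) ∪ (T (m + 1) ×ˢ S (m + 1))).card : ℝ) ≤
      ((T m ×ˢ S m).card : ℝ) + ((T (m + 1) ×ˢ S (m + 1)).card : ℝ) := by exact_mod_cast this
    have h2 := hc m
    have h3 := hc (m + 1)
    rw [pow_succ] at h3
    linarith
  · intro m p hp
    rcases Finset.mem_union.1 hp with hp | hp
    · exact ⟨hTb _ _ (Finset.mem_product.1 hp).1, hSb _ _ (Finset.mem_product.1 hp).2⟩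
    · exact ⟨hTb _ _ (Finset.mem_product.1 hp).1, hSb _ _ (Finset.mem_product.1 hp).2⟩
  · intro m p hp
    exact Finset.mem_union_left _ (Finset.mem_product.2 ⟨hTm _ _ hp.1, hSm _ _ hp.2⟩)
  · intro m p hp
    exact Finset.mem_union_right _ (Finset.mem_product.2 ⟨hTm _ _ hp.1, hSm _ _ hp.2⟩)

lemma tpPi_close {d : ℕ} {R : ℝ} (m : ℕ) {p : ℝ × EuclideanSpace ℝ (Fin d)} (hp : p ∈ tpD d R) :
    ‖(tpPi m p).2 - p.2‖ + |(tpPi m p).1 - p.1| ≤ (d + 1) * (1 / 2) ^ m := by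
  have h1 := tpSig_sub m p.2
  have h2 := tpTau_sub m p.1 hp.1.1.le
  simp only [tpPi]
  linarith

lemma tpPi_close_pair {d : ℕ} {R : ℝ} (m m' : ℕ) (hm : m ≤ m') {p q : ℝ × EuclideanSpace ℝ (Fin d)}
    (hp : p ∈ tpD d R) (hq : q ∈ tpD d R) (δ : ℝ) (hδ : ‖p.2 - q.2‖ + |p.1 - q.1| ≤ δ) :
    ‖(tpPi m p).2 - (tpPi m' q).2‖ + |(tpPi m' q).1 - (tpPi m p).1| ≤
      2 * (d + 1) * (1 / 2) ^ m + δ := by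
  have h1 := tpPi_close m hp
  have h2 := tpPi_close m' hq
  have h3 : ((1:ℝ) / 2) ^ m' ≤ (1 / 2) ^ m :=
    pow_le_pow_of_le_one (by norm_num) (by norm_num) hm
  have h3' : ((d:ℝ) + 1) * (1 / 2) ^ m' ≤ (d + 1) * (1 / 2) ^ m := by gcongr
  have e1 : (tpPi m p).2 - (tpPi m' q).2 =
    ((tpPi m p).2 - p.2) + (p.2 - q.2) - ((tpPi m' q).2 - q.2) := by abel
  have h4 : ‖(tpPi m p).2 - (tpPi m' q).2‖ ≤
      ‖(tpPi m p).2 - p.2‖ + ‖p.2 - q.2‖ + ‖(tpPi m' q).2 - q.2‖ := by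
    rw [e1]
    exact (norm_sub_le _ _).trans (by gcongr; exact norm_add_le _ _)
  have h5 : |(tpPi m' q).1 - (tpPi m p).1| ≤
      |(tpPi m p).1 - p.1| + |p.1 - q.1| + |(tpPi m' q).1 - q.1| := by
    rw [abs_sub_comm]
    have e2 : (tpPi m p).1 - (tpPi m' q).1 =
      ((tpPi m p).1 - p.1) + (p.1 - q.1) - ((tpPi m' q).1 - q.1) := by ring
    rw [e2]
    exact (abs_sub _ _).trans (by gcongr; exact abs_add_le _ _)
  linarith

/-- The good property of the sample path. -/
def tpGood {d : ℕ} (R : ℝ) (y : ℝ × EuclideanSpace ℝ (Fin d) → ℝ) (k J : ℕ) : Prop :=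
  ∀ j ≥ J, ∀ n ≤ k * j, ∀ p ∈ tpD d R, ∀ q ∈ tpD d R,
    (1 / 2 : ℝ) ^ n ≤ p.1 → (1 / 2 : ℝ) ^ n ≤ q.1 →
    (‖p.2 - q.2‖ + |p.1 - q.1| ≤ 2 * (1 / 2) ^ (n + j) →
      |y (tpPi (n + j) p) - y (tpPi (n + j) q)| ≤ (3 / 4 : ℝ) ^ j) ∧
    |y (tpPi (n + j) p) - y (tpPi (n + j + 1) p)| ≤ (3 / 4 : ℝ) ^ j

lemma tp_good' {d : ℕ} {R : ℝ} (hR : 0 < R) {Ω : Type*} [MeasurableSpace Ω] (P : Measure Ω)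
    (Y : ℝ × EuclideanSpace ℝ (Fin d) → Ω → ℝ) (C : ℝ) (hC : 0 < C)
    (hT : ∀ p ∈ tpD d R, ∀ q ∈ tpD d R, ∀ V > 0,
      C * (‖p.2 - q.2‖ + |q.1 - p.1|) / min q.1 p.1 ≤ V → ∀ t : ℝ, 0 ≤ t →
      P {ω | t ≤ |Y p ω - Y q ω|} ≤ ENNReal.ofReal (2 * Real.exp (-(t ^ 2 / (2 * V)))))
    (k : ℕ) :
    ∀ᵐ ω ∂P, ∃ J, tpGood R (fun p => Y p ω) k J := by
  obtain ⟨S, K, B, hK, hB, hcard, hSD, hS1, hS2⟩ := tp_grid d R hR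
  filter_upwards [tp_good P Y C hC hT S hSD K B (2 * (d + 1) + 2) hK hB (by positivity) hcard k]
    with ω hω
  obtain ⟨J, hJ⟩ := eventually_atTop.1 hω
  refine ⟨J, fun j hj n hn p hp q hq h1 h2 => ⟨fun h3 => ?_, ?_⟩⟩
  · apply hJ j hj n hn _ (hS1 _ _ hp) _ (hS1 _ _ hq)
    · exact h1.trans (tpTau_ge _ _)
    · exact h2.trans (tpTau_ge _ _)
    · have := tpPi_close_pair (n + j) (n + j) le_rfl hp hq _ h3
      linarith
  · apply hJ j hj n hn _ (hS1 _ _ hp) _ (hS2 _ _ hp)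
    · exact h1.trans (tpTau_ge _ _)
    · exact h1.trans (tpTau_ge _ _)
    · have := tpPi_close_pair (n + j) (n + j + 1) (by omega) hp hp 0 (by simp)
      have h0 : (0:ℝ) ≤ (1/2) ^ (n + j) := by positivity
      linarith

lemma tp_limit {d : ℕ} {R : ℝ} {y : ℝ × EuclideanSpace ℝ (Fin d) → ℝ} {k J : ℕ}
    (hy : tpGood R y k J) {n j : ℕ} (hj : J ≤ j) (hn : n ≤ k * j)
    {p : ℝ × EuclideanSpace ℝ (Fin d)} (hp : p ∈ tpD d R) (hnp : (1 / 2 : ℝ) ^ n ≤ p.1) :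
    Tendsto (fun m => y (tpPi m p)) atTop (nhds (limUnder atTop (fun m => y (tpPi m p)))) ∧
    |y (tpPi (n + j) p) - limUnder atTop (fun m => y (tpPi m p))| ≤ 4 * (3 / 4 : ℝ) ^ j := by
  have hstep : ∀ i, dist (y (tpPi (i + (n + j)) p)) (y (tpPi (i + 1 + (n + j)) p)) ≤
      (3 / 4) ^ j * (3 / 4 : ℝ) ^ i := by
    intro i
    have := (hy (j + i) (by omega) n (by nlinarith) p hp p hp hnp hnp).2
    rw [Real.dist_eq, ← pow_add]
    convert this using 5 <;> omega
  have hc : CauchySeq (fun i => y (tpPi (i + (n + j)) p)) :=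
    cauchySeq_of_le_geometric _ _ (by norm_num) hstep
  obtain ⟨l, hl⟩ := cauchySeq_tendsto_of_complete hc
  have hl' : Tendsto (fun m => y (tpPi m p)) atTop (nhds l) :=
    (tendsto_add_atTop_iff_nat (f := fun m => y (tpPi m p)) (n + j)).1 hl
  rw [hl'.limUnder_eq]
  refine ⟨hl', ?_⟩
  have := dist_le_of_le_geometric_of_tendsto₀ _ _ (by norm_num) hstep hl
  rw [Real.dist_eq, zero_add] at this
  refine this.trans (le_of_eq ?_)
  ring

lemma tp_cont {d : ℕ} {R : ℝ} {y : ℝ × EuclideanSpace ℝ (Fin d) → ℝ} {J : ℕ}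
    (hy : tpGood R y 1 J) :
    ContinuousOn (fun p => limUnder atTop (fun m => y (tpPi m p))) (tpD d R) := by
  rw [Metric.continuousOn_iff]
  intro p hp ε hε
  obtain ⟨n, hn⟩ := exists_pow_lt_of_lt_one (half_pos hp.1.1) (by norm_num : (1 / 2 : ℝ) < 1)
  obtain ⟨j0, hj0⟩ := exists_pow_lt_of_lt_one (by positivity : 0 < ε / 9)
    (by norm_num : (3 / 4 : ℝ) < 1)
  set j := max j0 (max J n) with hj
  have hjε : 9 * (3 / 4 : ℝ) ^ j < ε := by
    have : (3 / 4 : ℝ) ^ j ≤ (3 / 4) ^ j0 :=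
      pow_le_pow_of_le_one (by norm_num) (by norm_num) (le_max_left _ _)
    linarith
  have hJj : J ≤ j := by omega
  have hnj : n ≤ 1 * j := by omega
  have hp0 := hp.1.1
  refine ⟨min (p.1 / 2) ((1 / 2) ^ (n + j)), lt_min (by linarith) (by positivity), ?_⟩
  intro q hq hqp
  have hd1 : |q.1 - p.1| < min (p.1 / 2) ((1 / 2) ^ (n + j)) := by
    have : dist q.1 p.1 ≤ dist q p := by rw [Prod.dist_eq]; exact le_max_left _ _
    rw [Real.dist_eq] at this; linarith
  have hd2 : ‖q.2 - p.2‖ < min (p.1 / 2) ((1 / 2) ^ (n + j)) := by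
    have : dist q.2 p.2 ≤ dist q p := by rw [Prod.dist_eq]; exact le_max_right _ _
    rw [dist_eq_norm] at this; linarith
  have hm1 := min_le_left (p.1 / 2) (((1:ℝ) / 2) ^ (n + j))
  have hm2 := min_le_right (p.1 / 2) (((1:ℝ) / 2) ^ (n + j))
  have hnp : (1 / 2 : ℝ) ^ n ≤ p.1 := by linarith
  have hnq : (1 / 2 : ℝ) ^ n ≤ q.1 := by
    have := (abs_lt.1 (hd1.trans_le hm1)).1
    linarith
  have h1 := (tp_limit hy hJj hnj hp hnp).2
  have h2 := (tp_limit hy hJj hnj hq hnq).2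
  have h3 := (hy j hJj n hnj q hq p hp hnq hnp).1 (by linarith)
  rw [Real.dist_eq]
  rw [abs_le] at h1 h2 h3
  rw [abs_lt]
  constructor <;> linarith [h1.1, h1.2, h2.1, h2.2, h3.1, h3.2]

/-- modification -/
lemma tp_modif {d : ℕ} {R : ℝ} {Ω : Type*} [MeasurableSpace Ω] (P : Measure Ω)
    (Y : ℝ × EuclideanSpace ℝ (Fin d) → Ω → ℝ) (C : ℝ) (hC : 0 < C)
    (hT : ∀ p ∈ tpD d R, ∀ q ∈ tpD d R, ∀ V > 0,
      C * (‖p.2 - q.2‖ + |q.1 - p.1|) / min q.1 p.1 ≤ V → ∀ t : ℝ, 0 ≤ t →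
      P {ω | t ≤ |Y p ω - Y q ω|} ≤ ENNReal.ofReal (2 * Real.exp (-(t ^ 2 / (2 * V)))))
    (p : ℝ × EuclideanSpace ℝ (Fin d)) (hp : p ∈ tpD d R) :
    ∀ᵐ ω ∂P, limUnder atTop (fun m => Y (tpPi m p) ω) = Y p ω := by
  have hp0 := hp.1.1
  set c : ℝ := 1 / (2 * (C * (d + 1) / p.1)) with hc
  obtain ⟨M, hM0, hM⟩ := tp_superexp c 1 (9 / 8) (by positivity) (by positivity) (by norm_num)
  have key : ∀ j, P {ω | (3 / 4 : ℝ) ^ j ≤ |Y (tpPi j p) ω - Y p ω|} ≤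
      ENNReal.ofReal ((2 * M) * (1 / 2) ^ j) := by
    intro j
    have h3 := hT (tpPi j p) (tpPi_mem j hp) p hp (C * (d + 1) / p.1 * (1 / 2) ^ j)
      (by positivity) (by
        have hmin : min p.1 (tpPi j p).1 = p.1 := min_eq_left (tpTau_ge _ _)
        rw [hmin, abs_sub_comm]
        have := tpPi_close j hp
        calc _ ≤ C * ((d + 1) * (1 / 2) ^ j) / p.1 := by gcongr
          _ = _ := by ring) ((3 / 4) ^ j) (by positivity)
    refine h3.trans (ENNReal.ofReal_le_ofReal ?_)
    have e : ((3 / 4 : ℝ) ^ j) ^ 2 / (2 * (C * (d + 1) / p.1 * (1 / 2) ^ j)) = c * (9 / 8) ^ j := by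
      rw [hc, ← pow_mul, mul_comm j 2, pow_mul]
      have : ((3 / 4 : ℝ) ^ 2) ^ j = (9 / 8) ^ j * (1 / 2) ^ j := by
        rw [← mul_pow]; norm_num
      rw [this]
      field_simp
    rw [e]
    have := hM j
    rw [one_pow, one_mul] at this
    linarith
  filter_upwards [tp_bc P _ _ key] with ω hω
  apply Tendsto.limUnder_eq
  rw [tendsto_iff_dist_tendsto_zero]
  refine squeeze_zero' (Eventually.of_forall fun _ => dist_nonneg) ?_
    (tendsto_pow_atTop_nhds_zero_of_lt_one (by norm_num : (0:ℝ) ≤ 3 / 4) (by norm_num))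
  filter_upwards [hω] with j hj
  rw [Real.dist_eq]
  simp only [Set.mem_ofPred_eq, not_le] at hj
  exact hj.le

lemma tp_thick {d : ℕ} (hd : 0 < d) {R : ℝ} (hR : 0 < R) {Ω : Type*} [MeasurableSpace Ω]
    (P : Measure Ω) (Y : ℝ × EuclideanSpace ℝ (Fin d) → Ω → ℝ) (k : ℕ) (hk : 1 ≤ k)
    (β θ s : ℝ) (hs : 0 < s)
    (hkey : (k + 1) * (d - s) < k * (β ^ 2 / (2 * θ)))
    (hmeas : ∀ n : ℕ, ∀ x, AEMeasurable (Y ((1 / 2) ^ n, x)) P)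
    (hT : ∀ᶠ n : ℕ in atTop, ∀ x, P {ω | β * (n * Real.log 2) ≤ Y ((1 / 2) ^ n, x) ω} ≤
      ENNReal.ofReal (Real.exp (-(β ^ 2 / (2 * θ) * (n * Real.log 2))))) :
    ∀ᵐ ω ∂P, (μH[s] : Measure (EuclideanSpace ℝ (Fin d)))
      {x | x ∈ Metric.ball (0 : EuclideanSpace ℝ (Fin d)) R ∧
        ∀ᶠ j : ℕ in atTop, β * ((k * j : ℕ) * Real.log 2) ≤
          Y ((1 / 2) ^ (k * j), tpSig (k * j + j) x) ω} = 0 := by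
  classical
  obtain ⟨K, hK, hS⟩ := tpSig_finset d R hR
  choose S hSc hSb hSm using hS
  have hkj : Tendsto (fun j : ℕ => k * j) atTop atTop :=
    tendsto_id.const_mul_atTop' (by omega)
  obtain ⟨j0, hj0⟩ := eventually_atTop.1 (hkj.eventually hT)
  have hl2 : 0 < Real.log 2 := Real.log_pos (by norm_num)
  let A : ℕ → EuclideanSpace ℝ (Fin d) → Set Ω := fun j u =>
    {ω | β * ((k * j : ℕ) * Real.log 2) ≤ Y ((1 / 2) ^ (k * j), u) ω}
  let ρ : ℕ → ℝ := fun j => 2 * (d * (1 / 2) ^ (k * j + j))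
  have hρ0 : ∀ j, 0 < ρ j := fun j => by
    have : (0:ℝ) < d := by exact_mod_cast hd
    simp only [ρ]; positivity
  let W : ℕ → Ω → ENNReal := fun j ω =>
    ∑ u ∈ S (k * j + j), (A j u).indicator (fun _ => ENNReal.ofReal (ρ j) ^ s) ω
  have hAm : ∀ j u, NullMeasurableSet (A j u) P := fun j u =>
    nullMeasurableSet_le aemeasurable_const (hmeas _ _)
  have hWm : ∀ j, AEMeasurable (W j) P := fun j =>
    Finset.aemeasurable_fun_sum _ fun u _ => aemeasurable_const.indicator₀ (hAm j u)
  set q : ℝ := Real.exp (Real.log 2 * ((k + 1) * (d - s) - k * (β ^ 2 / (2 * θ)))) with hq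
  have hq1 : q < 1 := by
    rw [hq, Real.exp_lt_one_iff]
    exact mul_neg_of_pos_of_neg hl2 (by linarith)
  have hq0 : 0 < q := Real.exp_pos _
  have hW : ∀ j ≥ j0, ∫⁻ ω, W j ω ∂P ≤ ENNReal.ofReal (K * (2 * d) ^ s * q ^ j) := by
    intro j hj
    simp only [W]
    rw [lintegral_finsetSum' _ fun u _ => aemeasurable_const.indicator₀ (hAm j u)]
    have h1 : ∀ u ∈ S (k * j + j), ∫⁻ ω, (A j u).indicator (fun _ => ENNReal.ofReal (ρ j) ^ s) ω ∂P
        ≤ ENNReal.ofReal ((ρ j) ^ s *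
          Real.exp (-(β ^ 2 / (2 * θ) * ((k * j : ℕ) * Real.log 2)))) := by
      intro u _
      rw [lintegral_indicator_const₀ (hAm j u), ENNReal.ofReal_rpow_of_pos (hρ0 j),
        ENNReal.ofReal_mul (p := ρ j ^ s) (by have := hρ0 j; positivity)]
      gcongr
      exact hj0 j hj u
    refine (Finset.sum_le_sum h1).trans ?_
    rw [Finset.sum_const, nsmul_eq_mul, ← ENNReal.ofReal_natCast,
      ← ENNReal.ofReal_mul (by positivity)]
    apply ENNReal.ofReal_le_ofReal
    have h2 : (ρ j) ^ s = (2 * d) ^ s * Real.exp (-(Real.log 2 * ((k * j + j : ℕ) * s))) := by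
      simp only [ρ]
      rw [← mul_assoc, Real.mul_rpow (by positivity) (by positivity)]
      congr 1
      have e : ((1:ℝ) / 2) ^ (k * j + j) = Real.exp (-(Real.log 2 * (k * j + j : ℕ))) := by
        rw [Real.exp_neg, mul_comm (Real.log 2), Real.exp_nat_mul, Real.exp_log (by norm_num), one_div, inv_pow]
      rw [e, ← Real.exp_mul]
      congr 1; ring
    have h3 : ((2:ℝ) ^ d) ^ (k * j + j) = Real.exp (Real.log 2 * (d * (k * j + j : ℕ))) := by
      rw [← pow_mul]
      have e : Real.log 2 * (d * (k * j + j : ℕ)) = ((d * (k * j + j) : ℕ) : ℝ) * Real.log 2 := by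
        push_cast; ring
      rw [e, Real.exp_nat_mul, Real.exp_log (by norm_num)]
    have h4 : q ^ j = Real.exp (Real.log 2 * (d * (k * j + j : ℕ))) *
        Real.exp (-(Real.log 2 * ((k * j + j : ℕ) * s))) *
        Real.exp (-(β ^ 2 / (2 * θ) * ((k * j : ℕ) * Real.log 2))) := by
      rw [hq, ← Real.exp_nat_mul, ← Real.exp_add, ← Real.exp_add]
      congr 1
      push_cast; ring
    have h5 := hSc (k * j + j)
    rw [h3] at h5
    rw [h4, h2]
    calc _ ≤ (K * Real.exp (Real.log 2 * (d * (k * j + j : ℕ)))) * ((2 * d) ^ s *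
        Real.exp (-(Real.log 2 * ((k * j + j : ℕ) * s))) *
        Real.exp (-(β ^ 2 / (2 * θ) * ((k * j : ℕ) * Real.log 2)))) := by gcongr
      _ = _ := by ring
  have hsum : ∑' j, ∫⁻ ω, W (j + j0) ω ∂P ≠ ⊤ := by
    have h1 : Summable (fun j : ℕ => K * (2 * d) ^ s * q ^ (j + j0)) := by
      apply Summable.mul_left
      exact (summable_nat_add_iff j0).2 (summable_geometric_of_lt_one hq0.le hq1)
    exact ne_top_of_le_ne_top h1.tsum_ofReal_ne_top
      (ENNReal.tsum_le_tsum fun j => hW (j + j0) (by omega))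
  rw [← lintegral_tsum fun j => hWm (j + j0)] at hsum
  filter_upwards [ae_lt_top' (AEMeasurable.tsum fun j => hWm (j + j0)) hsum] with ω hω
  have hlim : Tendsto (fun j => W j ω) atTop (nhds 0) :=
    (tendsto_add_atTop_iff_nat (f := fun j => W j ω) j0).1
      (ENNReal.tendsto_atTop_zero_of_tsum_ne_top hω.ne)
  let T : ℕ → Set (EuclideanSpace ℝ (Fin d)) := fun J =>
    {x | x ∈ Metric.ball (0 : EuclideanSpace ℝ (Fin d)) R ∧ ∀ j ≥ J,
      β * ((k * j : ℕ) * Real.log 2) ≤ Y ((1 / 2) ^ (k * j), tpSig (k * j + j) x) ω}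
  have hTsub : {x | x ∈ Metric.ball (0 : EuclideanSpace ℝ (Fin d)) R ∧
        ∀ᶠ j : ℕ in atTop, β * ((k * j : ℕ) * Real.log 2) ≤
          Y ((1 / 2) ^ (k * j), tpSig (k * j + j) x) ω} ⊆ ⋃ J, T J := by
    rintro x ⟨hx, h⟩
    obtain ⟨J, hJ⟩ := eventually_atTop.1 h
    exact Set.mem_iUnion.2 ⟨J, hx, hJ⟩
  refine measure_mono_null hTsub (measure_iUnion_null fun J => ?_)
  have hr : Tendsto (fun j => ENNReal.ofReal (ρ j)) atTop (nhds 0) := by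
    rw [← ENNReal.ofReal_zero]
    apply ENNReal.tendsto_ofReal
    have : Tendsto (fun j : ℕ => k * j + j) atTop atTop :=
      tendsto_atTop_mono (fun j => Nat.le_add_left j (k * j)) tendsto_id
    have h2 := ((tendsto_pow_atTop_nhds_zero_of_lt_one (by norm_num : (0:ℝ) ≤ 1 / 2)
      (by norm_num)).comp this).const_mul (2 * (d : ℝ))
    rw [mul_zero] at h2
    refine h2.congr fun j => ?_
    simp only [ρ, Function.comp]; ring
  let t : ∀ j : ℕ, {u // u ∈ S (k * j + j)} → Set (EuclideanSpace ℝ (Fin d)) := fun j u =>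
    if ω ∈ A j u.1 then Metric.closedBall u.1 (d * (1 / 2) ^ (k * j + j)) else ∅
  have hdiam : ∀ j u, Metric.ediam (t j u) ≤ ENNReal.ofReal (ρ j) := by
    intro j u
    simp only [t]
    split_ifs
    · refine Metric.ediam_le fun x hx y hy => ?_
      rw [edist_dist]
      apply ENNReal.ofReal_le_ofReal
      have h1 := Metric.mem_closedBall.1 hx
      have h2 := Metric.mem_closedBall'.1 hy
      simp only [ρ]
      linarith [dist_triangle x u.1 y]
    · simp
  have hmain := Measure.hausdorffMeasure_le_liminf_sum s (T J) (l := atTop)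
    (fun j => ENNReal.ofReal (ρ j)) hr t (Eventually.of_forall fun j u => hdiam j u) (by
      filter_upwards [eventually_ge_atTop J] with j hj x hx
      obtain ⟨hx1, hx2⟩ := hx
      refine Set.mem_iUnion.2 ⟨⟨tpSig (k * j + j) x, hSm _ _ hx1⟩, ?_⟩
      have : ω ∈ A j (tpSig (k * j + j) x) := hx2 j hj
      simp only [t, if_pos this]
      rw [Metric.mem_closedBall', dist_eq_norm]
      exact tpSig_sub _ _)
  refine le_antisymm (hmain.trans ?_) bot_le
  rw [← hlim.liminf_eq]
  refine liminf_le_liminf (Eventually.of_forall fun j => ?_)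
  simp only [W]
  rw [← Finset.sum_coe_sort (S (k * j + j))]
  apply Finset.sum_le_sum
  intro u _
  by_cases h : ω ∈ A j u.1
  · rw [Set.indicator_of_mem h]
    gcongr
    exact hdiam j u
  · simp [t, if_neg h, hs]

lemma tp_params (D a s : ℝ) (ha : 0 < a) (hs : D - a ^ 2 / 2 < s) :
    ∃ k : ℕ, 1 ≤ k ∧ ∃ β θ : ℝ, 0 < β ∧ β < a ∧ 1 < θ ∧
      (k + 1) * (D - s) < k * (β ^ 2 / (2 * θ)) := by
  have h1 : Tendsto (fun δ : ℝ => (a - δ) ^ 2 / (2 * (1 + δ)) - (1 + δ) * (D - s)) (nhds 0)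
      (nhds ((a - 0) ^ 2 / (2 * (1 + 0)) - (1 + 0) * (D - s))) := by
    apply ContinuousAt.tendsto
      (f := fun δ : ℝ => (a - δ) ^ 2 / (2 * (1 + δ)) - (1 + δ) * (D - s))
    apply ContinuousAt.sub
    · apply ContinuousAt.div (by fun_prop) (by fun_prop) (by norm_num)
    · fun_prop
  have h2 := h1.comp (tendsto_one_div_add_atTop_nhds_zero_nat (𝕜 := ℝ))
  have h3 := h2.eventually (lt_mem_nhds (show 0 < (a - 0) ^ 2 / (2 * (1 + 0)) - (1 + 0) * (D - s) by
    simp; linarith))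
  have h4 := (tendsto_one_div_add_atTop_nhds_zero_nat (𝕜 := ℝ)).eventually (gt_mem_nhds ha)
  obtain ⟨k, hk1, hk2⟩ := (h3.and h4).exists
  simp only [Function.comp] at hk1
  set δ : ℝ := 1 / ((k:ℝ) + 1) with hδ
  have hδ0 : 0 < δ := by positivity
  refine ⟨k + 1, by omega, a - δ, 1 + δ, by linarith, by linarith, by linarith, ?_⟩
  have hk : ((k + 1 : ℕ) : ℝ) * δ = 1 := by rw [hδ]; push_cast; field_simp
  have hkp : (0:ℝ) < ((k + 1 : ℕ) : ℝ) := by positivity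
  have : ((k + 1 : ℕ) : ℝ) + 1 = ((k + 1 : ℕ) : ℝ) * (1 + δ) := by rw [mul_add, hk]; ring
  rw [this, mul_assoc]
  apply mul_lt_mul_of_pos_left _ hkp
  linarith

theorem thick_points_upper_bound
    (d : ℕ) (hd : 2 ≤ d) (R : ℝ) (hR : 0 < R)
    {Ω : Type*} [MeasurableSpace Ω] (P : Measure Ω) [IsProbabilityMeasure P]
    (X : ℝ → EuclideanSpace ℝ (Fin d) → Ω → ℝ)
    (hgauss : IsCenteredGaussianProcess P
      (fun p : (Set.Ioc (0:ℝ) 1) × EuclideanSpace ℝ (Fin d) => X p.1.1 p.2))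
    -- (A) : Hölder-type bound on increments
    (C : ℝ) (hC : 0 < C)
    (hA : ∀ ε ∈ Set.Ioc (0:ℝ) 1, ∀ η ∈ Set.Ioc (0:ℝ) 1,
      ∀ x ∈ Metric.ball (0 : EuclideanSpace ℝ (Fin d)) R,
      ∀ y ∈ Metric.ball (0 : EuclideanSpace ℝ (Fin d)) R,
      ∫ ω, (X ε x ω - X η y ω) ^ 2 ∂P ≤ C * (‖x - y‖ + |η - ε|) / min η ε)
    -- (B) : the variance does not depend on x and is asymptotically log(1/ε)
    (G : ℝ → ℝ)
    (hGvar : ∀ ε ∈ Set.Ioc (0:ℝ) 1, ∀ x : EuclideanSpace ℝ (Fin d),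
      ∫ ω, (X ε x ω) ^ 2 ∂P = G ε)
    (hGlim : Tendsto (fun ε => G ε / Real.log (1 / ε)) (nhdsWithin 0 (Set.Ioi 0)) (nhds 1)) :
    ∃ X' : ℝ → EuclideanSpace ℝ (Fin d) → Ω → ℝ,
      -- X' is a modification of X
      (∀ ε ∈ Set.Ioc (0:ℝ) 1, ∀ x : EuclideanSpace ℝ (Fin d),
        ∀ᵐ ω ∂P, X' ε x ω = X ε x ω) ∧
      -- X' is jointly continuous in (ε, x) on (0,1] × B(0,R)
      (∀ᵐ ω ∂P, ContinuousOn (fun p : ℝ × EuclideanSpace ℝ (Fin d) => X' p.1 p.2 ω)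
        (Set.Ioc (0:ℝ) 1 ×ˢ Metric.ball 0 R)) ∧
      -- upper bound for the Hausdorff dimension of the set of thick points
      (∀ a : ℝ, 0 ≤ a → a ≤ Real.sqrt (2 * d) →
        ∀ᵐ ω ∂P,
          dimH {x : EuclideanSpace ℝ (Fin d) | x ∈ Metric.ball 0 R ∧
              ∃ L : ℝ, a ≤ L ∧
                Tendsto (fun ε => X' ε x ω / G ε) (nhdsWithin 0 (Set.Ioi 0)) (nhds L)}
            ≤ ENNReal.ofReal ((d : ℝ) - a ^ 2 / 2)) := by
  classical
  have hd0 : 0 < d := by omega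
  let Y : ℝ × EuclideanSpace ℝ (Fin d) → Ω → ℝ := fun p => X p.1 p.2
  have hlaw1 : ∀ ε ∈ Set.Ioc (0:ℝ) 1, ∀ x, ∃ v : NNReal,
      Measure.map (X ε x) P = gaussianReal 0 v := by
    intro ε hε x
    obtain ⟨v, hv⟩ := hgauss 1 (fun _ => 1) (fun _ => (⟨ε, hε⟩, x))
    refine ⟨v, ?_⟩
    simpa using hv
  have hlaw2 : ∀ p ∈ tpD d R, ∀ q ∈ tpD d R, ∃ v : NNReal,
      Measure.map (fun ω => Y p ω - Y q ω) P = gaussianReal 0 v := by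
    intro p hp q hq
    obtain ⟨v, hv⟩ := hgauss 2 ![1, -1] ![(⟨p.1, hp.1⟩, p.2), (⟨q.1, hq.1⟩, q.2)]
    refine ⟨v, ?_⟩
    rw [← hv]
    congr 1
    funext ω
    simp [Fin.sum_univ_two, Y, sub_eq_add_neg]
  have hT : ∀ p ∈ tpD d R, ∀ q ∈ tpD d R, ∀ V > 0,
      C * (‖p.2 - q.2‖ + |q.1 - p.1|) / min q.1 p.1 ≤ V → ∀ t : ℝ, 0 ≤ t →
      P {ω | t ≤ |Y p ω - Y q ω|} ≤ ENNReal.ofReal (2 * Real.exp (-(t ^ 2 / (2 * V)))) := by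
    intro p hp q hq V hV hle t ht
    obtain ⟨v, hv⟩ := hlaw2 p hp q hq
    exact tp_gauss_tail_abs P _ v hv V t hV
      ((hA p.1 hp.1 q.1 hq.1 p.2 hp.2 q.2 hq.2).trans hle) ht
  have hdy : ∀ n : ℕ, ((1:ℝ) / 2) ^ n ∈ Set.Ioc (0:ℝ) 1 := fun n =>
    ⟨by positivity, pow_le_one₀ (by norm_num) (by norm_num)⟩
  have hmeas : ∀ n : ℕ, ∀ x, AEMeasurable (Y ((1 / 2) ^ n, x)) P := by
    intro n x
    obtain ⟨v, hv⟩ := hlaw1 _ (hdy n) x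
    apply AEMeasurable.of_map_ne_zero
    simp only [Y]
    rw [hv]; exact IsProbabilityMeasure.ne_zero _
  have hl2 : 0 < Real.log 2 := Real.log_pos (by norm_num)
  have hdt : Tendsto (fun n : ℕ => ((1:ℝ) / 2) ^ n) atTop (nhdsWithin 0 (Set.Ioi 0)) := by
    refine tendsto_nhdsWithin_iff.2 ⟨tendsto_pow_atTop_nhds_zero_of_lt_one (by norm_num)
      (by norm_num), Eventually.of_forall fun n => (hdy n).1⟩
  have hlog : ∀ n : ℕ, Real.log (1 / (1 / 2) ^ n) = n * Real.log 2 := by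
    intro n
    rw [one_div, one_div, inv_pow, inv_inv, Real.log_pow]
  have hGn : Tendsto (fun n : ℕ => G ((1 / 2) ^ n) / (n * Real.log 2)) atTop (nhds 1) := by
    refine (hGlim.comp hdt).congr fun n => ?_
    simp only [Function.comp, hlog]
  have hnl : Tendsto (fun n : ℕ => (n : ℝ) * Real.log 2) atTop atTop :=
    tendsto_natCast_atTop_atTop.atTop_mul_const hl2
  have hT1 : ∀ β θ : ℝ, 0 < β → 1 < θ → ∀ᶠ n : ℕ in atTop, ∀ x,
      P {ω | β * (n * Real.log 2) ≤ Y ((1 / 2) ^ n, x) ω} ≤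
      ENNReal.ofReal (Real.exp (-(β ^ 2 / (2 * θ) * (n * Real.log 2)))) := by
    intro β θ hβ hθ
    filter_upwards [hGn.eventually (gt_mem_nhds hθ), hnl.eventually_gt_atTop 0] with n hn hn0 x
    obtain ⟨v, hv⟩ := hlaw1 _ (hdy n) x
    have hGle : G ((1 / 2) ^ n) ≤ θ * (n * Real.log 2) := by
      rw [div_lt_iff₀ hn0] at hn; exact hn.le
    have := tp_gauss_tail P _ v hv (θ * (n * Real.log 2)) (β * (n * Real.log 2)) (by positivity)
      (by rw [hGvar _ (hdy n) x]; exact hGle) (by positivity)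
    refine this.trans (le_of_eq ?_)
    congr 3
    field_simp
  let X' : ℝ → EuclideanSpace ℝ (Fin d) → Ω → ℝ := fun ε x ω =>
    if (ε, x) ∈ tpD d R then limUnder atTop (fun m => Y (tpPi m (ε, x)) ω) else X ε x ω
  have hgood : ∀ᵐ ω ∂P, ∀ k, ∃ J, tpGood R (fun p => Y p ω) k J :=
    ae_all_iff.2 fun k => tp_good' hR P Y C hC hT k
  refine ⟨X', ?_, ?_, ?_⟩
  · intro ε hε x
    by_cases h : (ε, x) ∈ tpD d R
    · filter_upwards [tp_modif P Y C hC hT (ε, x) h] with ω hω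
      simp only [X', if_pos h]
      exact hω
    · exact Eventually.of_forall fun ω => by simp only [X', if_neg h]
  · filter_upwards [hgood] with ω hω
    obtain ⟨J, hJ⟩ := hω 1
    refine (tp_cont hJ).congr fun p hp => ?_
    have hp' : (p.1, p.2) ∈ tpD d R := hp
    simp only [X', if_pos hp']
  · intro a ha0 _
    rcases ha0.eq_or_lt with ha | ha
    · refine Eventually.of_forall fun ω => ?_
      refine (dimH_mono (Set.subset_univ _)).trans ?_
      rw [Real.dimH_univ_eq_finrank, ← ha]
      simp
    · have hs0 : ∀ i : ℕ, 0 < (d : ℝ) - a ^ 2 / 2 + 1 / ((i : ℝ) + 1) := by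
        intro i
        have h1 : a ^ 2 ≤ 2 * d := by
          have := Real.sq_sqrt (show (0:ℝ) ≤ 2 * d by positivity)
          rw [← this]; gcongr
        have h2 : 0 < 1 / ((i : ℝ) + 1) := by positivity
        linarith
      have main : ∀ i : ℕ, ∀ᵐ ω ∂P,
          dimH {x : EuclideanSpace ℝ (Fin d) | x ∈ Metric.ball 0 R ∧
              ∃ L : ℝ, a ≤ L ∧
                Tendsto (fun ε => X' ε x ω / G ε) (nhdsWithin 0 (Set.Ioi 0)) (nhds L)}
            ≤ ENNReal.ofReal ((d : ℝ) - a ^ 2 / 2 + 1 / ((i : ℝ) + 1)) := by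
        intro i
        set s : ℝ := (d : ℝ) - a ^ 2 / 2 + 1 / ((i : ℝ) + 1) with hs
        have hsa : (d : ℝ) - a ^ 2 / 2 < s := by
          have h2 : 0 < 1 / ((i : ℝ) + 1) := by positivity
          linarith
        obtain ⟨k, hk, β, θ, hβ, hβa, hθ, hkey⟩ := tp_params d a s ha hsa
        filter_upwards [hgood, tp_thick hd0 hR P Y k hk β θ s (hs0 i) hkey hmeas
          (hT1 β θ hβ hθ)] with ω hω hnull
        obtain ⟨J, hJ⟩ := hω k
        have hsub : {x : EuclideanSpace ℝ (Fin d) | x ∈ Metric.ball 0 R ∧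
              ∃ L : ℝ, a ≤ L ∧
                Tendsto (fun ε => X' ε x ω / G ε) (nhdsWithin 0 (Set.Ioi 0)) (nhds L)} ⊆
            {x | x ∈ Metric.ball (0 : EuclideanSpace ℝ (Fin d)) R ∧
              ∀ᶠ j : ℕ in atTop, β * ((k * j : ℕ) * Real.log 2) ≤
              Y ((1 / 2) ^ (k * j), tpSig (k * j + j) x) ω} := by
          rintro x ⟨hx, L, haL, hL⟩
          refine ⟨hx, ?_⟩
          have h1 : Tendsto (fun n : ℕ => X' ((1 / 2) ^ n) x ω / (n * Real.log 2)) atTop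
              (nhds L) := by
            have h2 := (hL.comp hdt).mul hGn
            rw [mul_one] at h2
            refine h2.congr' ?_
            filter_upwards [hGn.eventually (lt_mem_nhds (zero_lt_one))] with n hn
            have hG0 : G ((1 / 2) ^ n) ≠ 0 := by
              intro h0; rw [h0] at hn; simp at hn
            simp only [Function.comp]
            field_simp
          have h3 : ∀ᶠ n : ℕ in atTop, β * (n * Real.log 2) + 4 ≤ X' ((1 / 2) ^ n) x ω := by
            have hmid : (β + a) / 2 < L := by linarith
            filter_upwards [h1.eventually (lt_mem_nhds hmid), hnl.eventually_gt_atTop 0,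
              hnl.eventually_ge_atTop (8 / (a - β))] with n hn hn0 hn8
            rw [lt_div_iff₀ hn0] at hn
            rw [div_le_iff₀ (by linarith)] at hn8
            linarith
          have hkj : Tendsto (fun j : ℕ => k * j) atTop atTop :=
            tendsto_id.const_mul_atTop' (by omega)
          filter_upwards [hkj.eventually h3, eventually_ge_atTop J] with j hj hjJ
          have hmem : (((1:ℝ) / 2) ^ (k * j), x) ∈ tpD d R := ⟨hdy _, hx⟩
          have h4 := (tp_limit hJ hjJ (le_refl (k * j)) hmem le_rfl).2
          have h5 : tpPi (k * j + j) (((1:ℝ) / 2) ^ (k * j), x) =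
              ((1 / 2) ^ (k * j), tpSig (k * j + j) x) := by
            simp only [tpPi, tpTau_dyadic]
          rw [h5] at h4
          simp only [X', if_pos hmem] at hj
          have h6 : ((3:ℝ) / 4) ^ j ≤ 1 := pow_le_one₀ (by norm_num) (by norm_num)
          have h7 := (abs_le.1 h4).1
          linarith
        have hz := measure_mono_null hsub hnull
        have hcoe : ((Real.toNNReal s : NNReal) : ℝ) = s := Real.coe_toNNReal _ (hs0 i).le
        refine dimH_le_of_hausdorffMeasure_ne_top (d := Real.toNNReal s) ?_
        rw [hcoe, hz]
        exact ENNReal.zero_ne_top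
      filter_upwards [ae_all_iff.2 main] with ω hω
      have hlim : Tendsto (fun i : ℕ => ENNReal.ofReal ((d : ℝ) - a ^ 2 / 2 + 1 / ((i : ℝ) + 1)))
          atTop (nhds (ENNReal.ofReal ((d : ℝ) - a ^ 2 / 2))) := by
        apply ENNReal.tendsto_ofReal
        have := (tendsto_one_div_add_atTop_nhds_zero_nat (𝕜 := ℝ)).const_add ((d : ℝ) - a ^ 2 / 2)
        rwa [add_zero] at this
      exact ge_of_tendsto' hlim hω
end
end

section
/- Let d ≥ 2 and R > 0. Let (X_ε(x))_{ε∈(0,1], x∈ℝ^d} be a centered Gaussian process on a probability space (Ω, P) such that: (A) there is a constant C > 0 with E[(X_ε(x) − X_η(y))²] ≤ C·(‖x−y‖ + |η−ε|)/(min(η,ε)) for all x, y in the ball B(0,R) and all ε, η ∈ (0,1]; and (B) the variance G(ε) := E[X_ε(x)²] does not depend on x and satisfies G(ε)/log(1/ε) → 1 as ε → 0+. Then there exists a modification X̃ of the process, jointly continuous in (ε, x) on (0,1] × B(0,R), such that for every a > √(2d), almost surely the set T_≥(a,R) := {x ∈ B(0,R) : lim_{ε→0+} X̃_ε(x)/G(ε)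 exists and is ≥ a} is empty. -/
open MeasureTheory ProbabilityTheory Filter

noncomputable section

namespace ThickPts

set_option linter.unusedSectionVars false

variable {Ω : Type*} [MeasurableSpace Ω] {P : Measure Ω} [IsProbabilityMeasure P]

lemma gauss_aemeas {Z : Ω → ℝ} {v : NNReal} (h : P.map Z = gaussianReal 0 v) :
    AEMeasurable Z P := aemeasurable_of_map_neZero (by rw [h]; infer_instance)

lemma gauss_sq {Z : Ω → ℝ} {v : NNReal} (h : P.map Z = gaussianReal 0 v) :
    ∫ ω, (Z ω) ^ 2 ∂P = v := by
  have hZ := gauss_aemeas h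
  have h1 : ∫ ω, (Z ω) ^ 2 ∂P = ∫ x, x ^ 2 ∂(P.map Z) := by
    rw [integral_map hZ (by fun_prop)]
  rw [h1, h]
  have := variance_eq_integral (μ := gaussianReal 0 v) (X := fun x => x) (by fun_prop)
  rw [variance_fun_id_gaussianReal, integral_id_gaussianReal] at this
  simpa using this.symm

/-- one-sided Gaussian tail -/
lemma gauss_tail {Z : Ω → ℝ} {v : NNReal} (h : P.map Z = gaussianReal 0 v) {s t : ℝ}
    (hs : 0 < s) (hv : ∫ ω, (Z ω) ^ 2 ∂P ≤ s) (ht : 0 ≤ t) :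
    P {ω | t ≤ Z ω} ≤ ENNReal.ofReal (Real.exp (-(t ^ 2 / (2 * s)))) := by
  rw [gauss_sq h] at hv
  have hZ := gauss_aemeas h
  have hl : 0 ≤ t / s := by positivity
  have hintg : Integrable (fun ω => Real.exp (t / s * Z ω)) P := by
    have := integrable_exp_mul_gaussianReal (μ := 0) (v := v) (t / s)
    rw [← h] at this
    exact this.comp_aemeasurable hZ
  have h1 := measure_ge_le_exp_mul_mgf (μ := P) (X := Z) (t := t / s) t hl hintg
  rw [mgf_gaussianReal h, ← Real.exp_add] at h1
  have h2 : P.real {ω | t ≤ Z ω} ≤ Real.exp (-(t ^ 2 / (2 * s))) := by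
    refine h1.trans (Real.exp_le_exp.2 ?_)
    have : (v : ℝ) * (t / s) ^ 2 / 2 ≤ s * (t / s) ^ 2 / 2 := by gcongr
    have e : -(t / s) * t + (0 * (t / s) + s * (t / s) ^ 2 / 2) = -(t ^ 2 / (2 * s)) := by
      field_simp; ring
    linarith
  rw [← ENNReal.ofReal_toReal (measure_ne_top P _)]
  exact ENNReal.ofReal_le_ofReal h2

/-- polynomial two-sided tail -/
lemma gauss_poly_tail {Z : Ω → ℝ} {v : NNReal} (h : P.map Z = gaussianReal 0 v) {s t : ℝ}
    (hs : 0 < s) (hv : ∫ ω, (Z ω) ^ 2 ∂P ≤ s) (ht : 0 < t) (p : ℕ) :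
    P {ω | t ≤ |Z ω|} ≤ ENNReal.ofReal (2 * p.factorial * (2 * s / t ^ 2) ^ p) := by
  have h' : P.map (fun ω => - Z ω) = gaussianReal 0 v := by
    have := gaussianReal_map_neg (μ := 0) (v := v)
    rw [← h, AEMeasurable.map_map_of_aemeasurable (by fun_prop) (gauss_aemeas h)] at this
    simpa [Function.comp_def] using this
  have h1 := gauss_tail h hs hv ht.le
  have h2 := gauss_tail h' hs (by simpa using hv) ht.le
  have hsub : {ω | t ≤ |Z ω|} ⊆ {ω | t ≤ Z ω} ∪ {ω | t ≤ - Z ω} := by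
    intro ω hω; simpa [le_abs] using hω
  refine (measure_mono hsub).trans ((measure_union_le _ _).trans ((add_le_add h1 h2).trans ?_))
  rw [← ENNReal.ofReal_add (by positivity) (by positivity)]
  apply ENNReal.ofReal_le_ofReal
  have hx : 0 < t ^ 2 / (2 * s) := by positivity
  have h3 := Real.pow_div_factorial_le_exp (x := t ^ 2 / (2 * s)) hx.le p
  have hf : (0:ℝ) < p.factorial := by positivity
  have : Real.exp (-(t ^ 2 / (2 * s))) ≤ p.factorial * (2 * s / t ^ 2) ^ p := by
    rw [Real.exp_neg]
    refine (inv_anti₀ (by positivity) h3).trans_eq ?_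
    rw [inv_div, div_eq_mul_inv, ← inv_pow, inv_div]
  linarith

/-- Uniform polynomial tail bound for the increments. -/
def TailBd {ι : Type*} [Fintype ι] (P : Measure Ω) (Y : (ι → ℝ) → Ω → ℝ) (p : ℕ) (M : ℝ) : Prop :=
  ∀ (u v : ι → ℝ) (t : ℝ), 0 < t →
    P {ω | t ≤ |Y u ω - Y v ω|} ≤ ENNReal.ofReal (M * (‖u - v‖ / t ^ 2) ^ p)

variable {ι : Type*} [Fintype ι]

lemma TailBd.comp_affine {Y : (ι → ℝ) → Ω → ℝ} {p : ℕ} {M : ℝ} (hY : TailBd P Y p M)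
    (b : ι → ℝ) {h : ℝ} (hh : 0 < h) : TailBd P (fun u => Y (b + h • u)) p (M * h ^ p) := by
  intro u v t ht
  refine (hY _ _ t ht).trans_eq ?_
  congr 1
  have : b + h • u - (b + h • v) = h • (u - v) := by rw [smul_sub]; abel
  rw [this, norm_smul, Real.norm_of_nonneg hh.le, mul_div_assoc, mul_pow]; ring

/-- dyadic point -/
def dy (k : ℕ) (z : ι → ℕ) : ι → ℝ := fun i => (z i : ℝ) / 2 ^ k

lemma norm_dy_sub_le (k : ℕ) (z : ι → ℕ) :
    ‖dy (k + 1) z - dy k (fun i => z i / 2)‖ ≤ (1 / 2) ^ k := by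
  rw [pi_norm_le_iff_of_nonneg (by positivity)]
  intro i
  simp only [Pi.sub_apply, dy, Real.norm_eq_abs]
  have h1 : (z i : ℝ) = 2 * ((z i / 2 : ℕ) : ℝ) + ((z i % 2 : ℕ) : ℝ) := by
    exact_mod_cast (Nat.div_add_mod (z i) 2).symm
  have h2 : ((z i % 2 : ℕ) : ℝ) ≤ 1 := by exact_mod_cast (by omega : z i % 2 ≤ 1)
  have h3 : (0:ℝ) ≤ ((z i % 2 : ℕ) : ℝ) := by positivity
  have : (z i : ℝ) / 2 ^ (k + 1) - ((z i / 2 : ℕ) : ℝ) / 2 ^ k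
      = ((z i % 2 : ℕ) : ℝ) / 2 * (1 / 2) ^ k := by
    rw [h1]; simp only [pow_succ, div_pow, one_pow]; field_simp; ring
  rw [this, abs_of_nonneg (by positivity)]
  have : (0:ℝ) < (1/2) ^ k := by positivity
  nlinarith

def KC (n p : ℕ) : ℝ := 2 * 2 ^ n * 16 ^ p

lemma pow_aux {n p : ℕ} (hp : 6 * (n + 1) ≤ p) : (2:ℝ) ^ n * (8 / 9) ^ p ≤ 1 / 2 := by
  have h1 : ((8:ℝ) / 9) ^ p ≤ (8 / 9) ^ (6 * (n + 1)) :=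
    pow_le_pow_of_le_one (by norm_num) (by norm_num) hp
  have h2 : ((8:ℝ) / 9) ^ (6 * (n + 1)) ≤ (1 / 2) ^ (n + 1) := by
    rw [pow_mul]; apply pow_le_pow_left₀ (by positivity); norm_num
  calc (2:ℝ) ^ n * (8 / 9) ^ p ≤ 2 ^ n * (1 / 2) ^ (n + 1) := by gcongr; exact h1.trans h2
    _ = 1 / 2 := by rw [pow_succ, ← mul_assoc, ← mul_pow]; norm_num

/-- the chaining bound -/
lemma chain {Y : (ι → ℝ) → Ω → ℝ} {p : ℕ} {M : ℝ} (hY : TailBd P Y p M) (hM : 0 ≤ M)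
    (hp : 6 * (Fintype.card ι + 1) ≤ p) {s : ℝ} (hs : 0 < s) :
    P {ω | ∃ (k : ℕ) (z : ι → ℕ), (∀ i, z i < 2 ^ k) ∧ s < |Y (dy k z) ω - Y 0 ω|}
      ≤ ENNReal.ofReal (KC (Fintype.card ι) p * M / (s ^ 2) ^ p) := by
  classical
  set n := Fintype.card ι
  let t : ℕ → ℝ := fun k => s / 4 * (3 / 4) ^ k
  have htpos : ∀ k, 0 < t k := fun k => by positivity
  let B : ℕ → Set Ω := fun k => ⋃ z ∈ Fintype.piFinset (fun _ : ι => Finset.range (2 ^ (k + 1))),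
    {ω | t k ≤ |Y (dy (k + 1) z) ω - Y (dy k (fun i => z i / 2)) ω|}
  have hB : ∀ k, P (B k) ≤ ENNReal.ofReal (2 ^ n * M * (16 / s ^ 2) ^ p * (1 / 2) ^ k) := by
    intro k
    refine (measure_biUnion_finset_le _ _).trans ?_
    have h1 : ∀ z ∈ Fintype.piFinset (fun _ : ι => Finset.range (2 ^ (k + 1))),
        P {ω | t k ≤ |Y (dy (k + 1) z) ω - Y (dy k (fun i => z i / 2)) ω|}
        ≤ ENNReal.ofReal (M * (16 / s ^ 2 * (8 / 9) ^ k) ^ p) := by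
      intro z _
      refine (hY _ _ _ (htpos k)).trans (ENNReal.ofReal_le_ofReal ?_)
      gcongr
      calc ‖dy (k + 1) z - dy k (fun i => z i / 2)‖ / t k ^ 2
          ≤ (1 / 2) ^ k / t k ^ 2 := by gcongr; exact norm_dy_sub_le k z
        _ = 16 / s ^ 2 * (8 / 9) ^ k := by
          simp only [t]
          rw [mul_pow, ← pow_mul, mul_comm k 2, pow_mul]
          rw [show (8 / 9 : ℝ) = (1 / 2) / (3 / 4) ^ 2 by norm_num, div_pow _ ((3 / 4 : ℝ) ^ 2)]
          field_simp
          norm_num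
    refine (Finset.sum_le_sum h1).trans ?_
    rw [Finset.sum_const, Fintype.card_piFinset, Finset.prod_const, Finset.card_univ,
      Finset.card_range, nsmul_eq_mul,
      ← ENNReal.ofReal_natCast, ← ENNReal.ofReal_mul (by positivity)]
    apply ENNReal.ofReal_le_ofReal
    have h2 : ((2:ℝ) ^ n * (8 / 9) ^ p) ^ k ≤ (1 / 2) ^ k :=
      pow_le_pow_left₀ (by positivity) (pow_aux hp) k
    calc (((2 ^ (k + 1)) ^ n : ℕ) : ℝ) * (M * (16 / s ^ 2 * (8 / 9) ^ k) ^ p)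
        = 2 ^ n * M * (16 / s ^ 2) ^ p * ((2:ℝ) ^ n * (8 / 9) ^ p) ^ k := by
          push_cast
          rw [mul_pow (16 / s ^ 2), mul_pow ((2:ℝ) ^ n), ← pow_mul, ← pow_mul, ← pow_mul, ← pow_mul]
          rw [show (k + 1) * n = n + n * k by ring, pow_add, mul_comm k p]
          ring
      _ ≤ _ := by gcongr
  have hsub : {ω | ∃ (k : ℕ) (z : ι → ℕ), (∀ i, z i < 2 ^ k) ∧ s < |Y (dy k z) ω - Y 0 ω|}
      ⊆ ⋃ k, B k := by
    intro ω hω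
    by_contra hcon
    simp only [B, Set.mem_iUnion, not_exists, Set.mem_ofPred_eq, not_le, Fintype.mem_piFinset,
      Finset.mem_range] at hcon
    obtain ⟨k, z, hz, hlt⟩ := hω
    have key : ∀ (k : ℕ) (z : ι → ℕ), (∀ i, z i < 2 ^ k) →
        |Y (dy k z) ω - Y 0 ω| ≤ s * (1 - (3 / 4) ^ k) := by
      intro k
      induction k with
      | zero =>
        intro z hz
        have : dy 0 z = (0 : ι → ℝ) := by
          ext i; have := hz i; simp at this; simp [dy, this]
        simp [this]
      | succ k ih =>
        intro z hz
        have h1 := (hcon k z hz).le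
        have h2 := ih (fun i => z i / 2) (fun i => by have := hz i; rw [pow_succ] at this; omega)
        have h3 := abs_sub_le (Y (dy (k + 1) z) ω) (Y (dy k (fun i => z i / 2)) ω) (Y 0 ω)
        have : s * (1 - (3 / 4) ^ (k + 1)) = t k + s * (1 - (3 / 4) ^ k) := by
          simp only [t, pow_succ]; ring
        linarith
    have := key k z hz
    have h4 : (0:ℝ) < s * (3 / 4) ^ k := by positivity
    linarith
  refine (measure_mono hsub).trans ((measure_iUnion_le _).trans ((ENNReal.tsum_le_tsum hB).trans ?_))
  have hsum : HasSum (fun k : ℕ => 2 ^ n * M * (16 / s ^ 2) ^ p * (1 / 2 : ℝ) ^ k)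
      (2 ^ n * M * (16 / s ^ 2) ^ p * 2) := hasSum_geometric_two.mul_left _
  rw [← ENNReal.ofReal_tsum_of_nonneg (fun k => by positivity) hsum.summable, hsum.tsum_eq]
  apply ENNReal.ofReal_le_ofReal
  apply le_of_eq
  rw [div_pow, KC]; ring

/-- if probabilities of bad sets tend to zero, then a.s. infinitely many are avoided -/
lemma ae_frequently_of_tendsto {B : ℕ → Set Ω} {f : ℕ → ℝ} (hf : Tendsto f atTop (nhds 0))
    (hB : ∀ᶠ N in atTop, P (B N) ≤ ENNReal.ofReal (f N)) :
    ∀ᵐ ω ∂P, ∃ᶠ N in atTop, ω ∉ B N := by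
  have h0 : Tendsto (fun N => P (B N)) atTop (nhds 0) := by
    have : Tendsto (fun N => ENNReal.ofReal (f N)) atTop (nhds 0) := by
      simpa using ENNReal.tendsto_ofReal hf
    exact tendsto_of_tendsto_of_tendsto_of_le_of_le' tendsto_const_nhds this
      (Eventually.of_forall fun _ => zero_le) hB
  have : P {ω | ∀ᶠ N in atTop, ω ∈ B N} = 0 := by
    have hsub : {ω | ∀ᶠ N in atTop, ω ∈ B N} ⊆ ⋃ m, ⋂ N ≥ m, B N := by
      intro ω hω
      obtain ⟨m, hm⟩ := eventually_atTop.1 hω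
      exact Set.mem_iUnion.2 ⟨m, Set.mem_iInter₂.2 hm⟩
    refine measure_mono_null hsub (measure_iUnion_null fun m => ?_)
    refine le_antisymm (ge_of_tendsto h0 ?_) zero_le
    filter_upwards [eventually_ge_atTop m] with N hN
    exact measure_mono (Set.iInter₂_subset N hN)
  rw [ae_iff]
  convert this using 3
  simp [Filter.Frequently]

end ThickPts

namespace ThickPts

set_option linter.unusedSectionVars false

variable {Ω : Type*} [MeasurableSpace Ω] {P : Measure Ω} [IsProbabilityMeasure P]
variable {ι : Type*} [Fintype ι]

lemma grid_card [DecidableEq ι] (m : ℕ) :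
    ((Fintype.piFinset (fun _ : ι => Finset.Icc (-(m:ℤ)) m)).card : ℝ)
      = (2 * m + 1) ^ (Fintype.card ι) := by
  rw [Fintype.card_piFinset, Finset.prod_const, Finset.card_univ, Int.card_Icc]
  have : ((m:ℤ) + 1 - -(m:ℤ)).toNat = 2 * m + 1 := by omega
  rw [this]; push_cast; rfl

/-- the grid point with integer coordinates `z` and mesh `g` -/
def gr (g : ℝ) (z : ι → ℤ) : ι → ℝ := fun i => g * z i

lemma cells {Y : (ι → ℝ) → Ω → ℝ} {p : ℕ} {M : ℝ} (hY : TailBd P Y p M) (hM : 0 ≤ M)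
    (hp : 6 * (Fintype.card ι + 1) ≤ p) {s : ℝ} (hs : 0 < s) (g : ℝ) {h : ℝ} (hh : 0 < h)
    (m : ℕ) :
    P {ω | ∃ (z : ι → ℤ) (k : ℕ) (w : ι → ℕ), (∀ i, |z i| ≤ m) ∧ (∀ i, w i < 2 ^ k) ∧
        s < |Y (gr g z + h • dy k w) ω - Y (gr g z) ω|}
      ≤ ENNReal.ofReal ((2 * m + 1) ^ (Fintype.card ι) *
          (KC (Fintype.card ι) p * (M * h ^ p) / (s ^ 2) ^ p)) := by
  classical
  have hsub : {ω | ∃ (z : ι → ℤ) (k : ℕ) (w : ι → ℕ), (∀ i, |z i| ≤ m) ∧ (∀ i, w i < 2 ^ k) ∧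
        s < |Y (gr g z + h • dy k w) ω - Y (gr g z) ω|} ⊆
      ⋃ z ∈ Fintype.piFinset (fun _ : ι => Finset.Icc (-(m:ℤ)) m),
        {ω | ∃ (k : ℕ) (w : ι → ℕ), (∀ i, w i < 2 ^ k) ∧
          s < |Y (gr g z + h • dy k w) ω - Y (gr g z + h • (0 : ι → ℝ)) ω|} := by
    rintro ω ⟨z, k, w, hz, hw, hlt⟩
    refine Set.mem_iUnion₂.2 ⟨z, ?_, k, w, hw, by simpa using hlt⟩
    simp only [Fintype.mem_piFinset, Finset.mem_Icc]
    exact fun i => abs_le.1 (hz i)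
  refine (measure_mono hsub).trans ((measure_biUnion_finset_le _ _).trans ?_)
  have h1 : ∀ z ∈ Fintype.piFinset (fun _ : ι => Finset.Icc (-(m:ℤ)) m),
      P {ω | ∃ (k : ℕ) (w : ι → ℕ), (∀ i, w i < 2 ^ k) ∧
          s < |Y (gr g z + h • dy k w) ω - Y (gr g z + h • (0 : ι → ℝ)) ω|}
      ≤ ENNReal.ofReal (KC (Fintype.card ι) p * (M * h ^ p) / (s ^ 2) ^ p) := by
    intro z _
    exact chain (hY.comp_affine (gr g z) hh) (by positivity) hp hs
  refine (Finset.sum_le_sum h1).trans ?_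
  rw [Finset.sum_const, nsmul_eq_mul, ← ENNReal.ofReal_natCast,
    ← ENNReal.ofReal_mul (by positivity), grid_card]

/-- dyadic points of the whole space -/
def IsDy (u : ι → ℝ) : Prop := ∃ (k : ℕ) (z : ι → ℤ), ∀ i, u i = z i / 2 ^ k

/-- a dyadic point in the cell of corner `2⁻ᴺ z` and side `2·2⁻ᴺ` -/
lemma dy_cell {u : ι → ℝ} (hu : IsDy u) (N : ℕ) (z : ι → ℤ)
    (h1 : ∀ i, (z i : ℝ) ≤ u i * 2 ^ N) (h2 : ∀ i, u i * 2 ^ N < z i + 2) :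
    ∃ (k : ℕ) (w : ι → ℕ), (∀ i, w i < 2 ^ k) ∧
      u = gr ((1 / 2) ^ N) z + (2 * (1 / 2) ^ N : ℝ) • dy k w := by
  obtain ⟨k, a, ha⟩ := hu
  have hk : (0:ℝ) < 2 ^ k := by positivity
  have hN : (0:ℝ) < 2 ^ N := by positivity
  have e1 : ∀ i, (0:ℤ) ≤ a i * 2 ^ N - z i * 2 ^ k := by
    intro i
    have := h1 i
    rw [ha i, div_mul_eq_mul_div, le_div_iff₀ hk] at this
    have : z i * 2 ^ k ≤ a i * 2 ^ N := by exact_mod_cast this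
    omega
  have e2 : ∀ i, a i * 2 ^ N - z i * 2 ^ k < 2 ^ (k + 1) := by
    intro i
    have := h2 i
    rw [ha i, div_mul_eq_mul_div, div_lt_iff₀ hk] at this
    have : a i * 2 ^ N < (z i + 2) * 2 ^ k := by exact_mod_cast this
    rw [pow_succ]; linarith
  refine ⟨k + 1, fun i => (a i * 2 ^ N - z i * 2 ^ k).toNat, fun i => ?_, ?_⟩
  · have := e2 i
    zify
    rw [Int.toNat_of_nonneg (e1 i)]
    exact this
  · ext i
    simp only [gr, dy, Pi.add_apply, Pi.smul_apply, smul_eq_mul]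
    have : (((a i * 2 ^ N - z i * 2 ^ k).toNat : ℕ) : ℝ) = a i * 2 ^ N - z i * 2 ^ k := by
      have := Int.toNat_of_nonneg (e1 i)
      have h3 : (((a i * 2 ^ N - z i * 2 ^ k).toNat : ℤ) : ℝ)
        = ((a i * 2 ^ N - z i * 2 ^ k : ℤ) : ℝ) := by rw [this]
      push_cast at h3
      simpa using h3
    rw [this, ha i, pow_succ, one_div, inv_pow]
    field_simp
    ring

lemma uc {Y : (ι → ℝ) → Ω → ℝ} {p : ℕ} {M : ℝ} (hY : TailBd P Y p M) (hM : 0 ≤ M)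
    (hp : 6 * (Fintype.card ι + 1) ≤ p) {s : ℝ} (hs : 0 < s) (A : ℕ) :
    ∀ᵐ ω ∂P, ∃ δ > 0, ∀ u v, IsDy u → IsDy v → ‖u‖ ≤ A → ‖v‖ ≤ A → ‖u - v‖ < δ →
      |Y u ω - Y v ω| ≤ s := by
  set n := Fintype.card ι
  have hKC : 0 ≤ KC n p := by unfold KC; positivity
  let B : ℕ → Set Ω := fun N => {ω | ∃ (z : ι → ℤ) (k : ℕ) (w : ι → ℕ),
    (∀ i, |z i| ≤ (A * 2 ^ N + 1 : ℕ)) ∧ (∀ i, w i < 2 ^ k) ∧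
      s / 2 < |Y (gr ((1 / 2) ^ N) z + (2 * (1 / 2) ^ N : ℝ) • dy k w) ω
        - Y (gr ((1 / 2) ^ N) z) ω|}
  let f : ℕ → ℝ := fun N => ((2 * A + 3) ^ n * (KC n p * (M * 2 ^ p) / ((s / 2) ^ 2) ^ p))
    * (1 / 2) ^ N
  have hf : Tendsto f atTop (nhds 0) := by
    have := (tendsto_pow_atTop_nhds_zero_of_lt_one (r := (1 / 2 : ℝ)) (by norm_num)
      (by norm_num)).const_mul ((2 * A + 3) ^ n * (KC n p * (M * 2 ^ p) / ((s / 2) ^ 2) ^ p))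
    simpa [f] using this
  have hB : ∀ N, P (B N) ≤ ENNReal.ofReal (f N) := by
    intro N
    refine (cells hY hM hp (half_pos hs) ((1 / 2) ^ N) (h := 2 * (1 / 2) ^ N) (by positivity)
      (A * 2 ^ N + 1)).trans (ENNReal.ofReal_le_ofReal ?_)
    have h1 : (2 * ((A * 2 ^ N + 1 : ℕ) : ℝ) + 1) ≤ (2 * A + 3) * 2 ^ N := by
      have : (1:ℝ) ≤ 2 ^ N := one_le_pow₀ (by norm_num)
      push_cast; nlinarith
    have h2 : ((2:ℝ) ^ n * (1 / 2) ^ p) ^ N ≤ (1 / 2) ^ N := by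
      apply pow_le_pow_left₀ (by positivity)
      calc (2:ℝ) ^ n * (1 / 2) ^ p ≤ 2 ^ n * (1 / 2) ^ (n + 1) := by
            gcongr ?_ * ?_
            exact pow_le_pow_of_le_one (by norm_num) (by norm_num) (by omega)
        _ = 1 / 2 := by rw [pow_succ, ← mul_assoc, ← mul_pow]; norm_num
    calc (2 * ((A * 2 ^ N + 1 : ℕ) : ℝ) + 1) ^ n *
          (KC n p * (M * (2 * (1 / 2) ^ N) ^ p) / ((s / 2) ^ 2) ^ p)
        ≤ ((2 * A + 3) * 2 ^ N) ^ n *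
          (KC n p * (M * (2 * (1 / 2) ^ N) ^ p) / ((s / 2) ^ 2) ^ p) := by gcongr
      _ = ((2 * A + 3) ^ n * (KC n p * (M * 2 ^ p) / ((s / 2) ^ 2) ^ p))
            * ((2:ℝ) ^ n * (1 / 2) ^ p) ^ N := by
          have q1 : ((2:ℝ) ^ N) ^ n = (2 ^ n) ^ N := pow_right_comm _ _ _
          have q2 : ((1 / 2 : ℝ) ^ N) ^ p = ((1 / 2) ^ p) ^ N := pow_right_comm _ _ _
          rw [mul_pow _ _ n, mul_pow _ _ p, mul_pow _ _ N, q1, q2]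
          ring
      _ ≤ _ := mul_le_mul_of_nonneg_left h2 (by positivity)
  filter_upwards [ae_frequently_of_tendsto hf (Eventually.of_forall hB)] with ω hω
  obtain ⟨N, hN⟩ := hω.exists
  refine ⟨(1 / 2) ^ N, by positivity, fun u v hu hv huA hvA huv => ?_⟩
  let z : ι → ℤ := fun i => ⌊min (u i) (v i) * 2 ^ N⌋
  have h2N : (0:ℝ) < 2 ^ N := by positivity
  have hcoord : ∀ i, |u i - v i| * 2 ^ N < 1 := by
    intro i
    have h1 : |u i - v i| ≤ ‖u - v‖ := norm_le_pi_norm (u - v) i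
    have h3 := lt_of_le_of_lt h1 huv
    rw [one_div, inv_pow, ← one_div, lt_div_iff₀ h2N] at h3
    exact h3
  have hz1 : ∀ i, (z i : ℝ) ≤ min (u i) (v i) * 2 ^ N := fun i => Int.floor_le _
  have hz2 : ∀ i, min (u i) (v i) * 2 ^ N < z i + 1 := fun i => Int.lt_floor_add_one _
  have hmax : ∀ i, max (u i) (v i) * 2 ^ N < z i + 2 := by
    intro i
    have := hcoord i
    rw [← max_sub_min_eq_abs', sub_mul] at this
    have := hz2 i
    linarith
  have hzA : ∀ i, |z i| ≤ (A * 2 ^ N + 1 : ℕ) := by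
    intro i
    have hu' : |u i| ≤ A := (norm_le_pi_norm u i).trans huA
    have hv' : |v i| ≤ A := (norm_le_pi_norm v i).trans hvA
    have hmin1 : -(A:ℝ) ≤ min (u i) (v i) := le_min (abs_le.1 hu').1 (abs_le.1 hv').1
    have hmin2 : min (u i) (v i) ≤ A := (min_le_left _ _).trans (abs_le.1 hu').2
    have a1 := hz1 i
    have a2 := hz2 i
    have a3 : min (u i) (v i) * 2 ^ N ≤ A * 2 ^ N := by gcongr
    have a4 : -(A:ℝ) * 2 ^ N ≤ min (u i) (v i) * 2 ^ N := by gcongr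
    have : |(z i : ℝ)| ≤ A * 2 ^ N + 1 := abs_le.2 ⟨by linarith, by linarith⟩
    exact_mod_cast this
  have hbd : ∀ x, IsDy x → (∀ i, min (u i) (v i) ≤ x i) → (∀ i, x i ≤ max (u i) (v i)) →
      |Y x ω - Y (gr ((1 / 2) ^ N) z) ω| ≤ s / 2 := by
    intro x hx hx1 hx2
    obtain ⟨k, w, hw, hxe⟩ := dy_cell hx N z
      (fun i => (hz1 i).trans (by gcongr; exact hx1 i))
      (fun i => lt_of_le_of_lt (by gcongr; exact hx2 i) (hmax i))
    by_contra hcon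
    rw [not_le, hxe] at hcon
    exact hN ⟨z, k, w, hzA, hw, hcon⟩
  have b1 := hbd u hu (fun i => min_le_left _ _) (fun i => le_max_left _ _)
  have b2 := hbd v hv (fun i => min_le_right _ _) (fun i => le_max_right _ _)
  have b3 := abs_sub_le (Y u ω) (Y (gr ((1 / 2) ^ N) z) ω) (Y v ω)
  rw [abs_sub_comm (Y (gr ((1 / 2) ^ N) z) ω)] at b3
  linarith

lemma tailBd_of_var {Y : (ι → ℝ) → Ω → ℝ} {c : ℝ} (hc : 0 < c)
    (hg : ∀ u v, ∃ σ : NNReal, P.map (fun ω => Y u ω - Y v ω) = gaussianReal 0 σ)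
    (hvar : ∀ u v, ∫ ω, (Y u ω - Y v ω) ^ 2 ∂P ≤ c * ‖u - v‖) (p : ℕ) :
    TailBd P Y p (2 * p.factorial * (2 * c) ^ p) := by
  intro u v t ht
  obtain ⟨σ, hσ⟩ := hg u v
  rcases eq_or_ne u v with rfl | huv
  · have : {ω | t ≤ |Y u ω - Y u ω|} = ∅ := by
      ext ω; simpa using ht
    rw [this]; simp
  · have : 0 < ‖u - v‖ := norm_pos_iff.2 (sub_ne_zero.2 huv)
    refine (gauss_poly_tail hσ (s := c * ‖u - v‖) (by positivity) (hvar u v) ht p).trans_eq ?_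
    congr 1
    rw [show 2 * (c * ‖u - v‖) / t ^ 2 = (2 * c) * (‖u - v‖ / t ^ 2) by ring, mul_pow]
    ring

section retr
variable {E : Type*} [NormedAddCommGroup E] [NormedSpace ℝ E]

/-- radial retraction onto the closed ball -/
def retr (r : ℝ) (x : E) : E := (r / max r ‖x‖) • x

lemma retr_of_le {r : ℝ} (hr : 0 < r) {x : E} (hx : ‖x‖ ≤ r) : retr r x = x := by
  rw [retr, max_eq_left hx, div_self hr.ne', one_smul]

lemma norm_retr_le {r : ℝ} (hr : 0 < r) (x : E) : ‖retr r x‖ ≤ r := by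
  have h : 0 < max r ‖x‖ := lt_max_of_lt_left hr
  rw [retr, norm_smul, Real.norm_of_nonneg (by positivity), div_mul_eq_mul_div, div_le_iff₀ h]
  gcongr
  exact le_max_right _ _

lemma norm_retr_sub_le {r : ℝ} (hr : 0 < r) (x y : E) : ‖retr r x - retr r y‖ ≤ 2 * ‖x - y‖ := by
  have hx : 0 < max r ‖x‖ := lt_max_of_lt_left hr
  have hy : 0 < max r ‖y‖ := lt_max_of_lt_left hr
  have e : retr r x - retr r y
      = (r / max r ‖x‖) • (x - y) + (r / max r ‖x‖ - r / max r ‖y‖) • y := by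
    simp only [retr]; module
  have h1 : ‖(r / max r ‖x‖) • (x - y)‖ ≤ ‖x - y‖ := by
    rw [norm_smul, Real.norm_of_nonneg (by positivity)]
    have : r / max r ‖x‖ ≤ 1 := (div_le_one hx).2 (le_max_left _ _)
    exact mul_le_of_le_one_left (norm_nonneg _) this
  have h2 : ‖(r / max r ‖x‖ - r / max r ‖y‖) • y‖ ≤ ‖x - y‖ := by
    rw [norm_smul, Real.norm_eq_abs]
    have e2 : r / max r ‖x‖ - r / max r ‖y‖
        = (r / max r ‖x‖) * ((max r ‖y‖ - max r ‖x‖) / max r ‖y‖) := by field_simp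
    have h3 : |max r ‖y‖ - max r ‖x‖| ≤ ‖x - y‖ := by
      have := abs_max_sub_max_le_abs ‖y‖ ‖x‖ r
      rw [max_comm r, max_comm r]
      refine this.trans ?_
      rw [norm_sub_rev]
      exact abs_norm_sub_norm_le y x
    rw [e2, abs_mul, abs_of_nonneg (a := r / max r ‖x‖) (by positivity), abs_div, abs_of_pos hy]
    have a1 : r / max r ‖x‖ ≤ 1 := (div_le_one hx).2 (le_max_left _ _)
    have a2 : ‖y‖ / max r ‖y‖ ≤ 1 := (div_le_one hy).2 (le_max_right _ _)
    calc r / max r ‖x‖ * (|max r ‖y‖ - max r ‖x‖| / max r ‖y‖) * ‖y‖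
        = (r / max r ‖x‖) * (‖y‖ / max r ‖y‖) * |max r ‖y‖ - max r ‖x‖| := by ring
      _ ≤ 1 * 1 * ‖x - y‖ := by gcongr
      _ = ‖x - y‖ := by ring
  rw [e]
  linarith [norm_add_le ((r / max r ‖x‖) • (x - y)) ((r / max r ‖x‖ - r / max r ‖y‖) • y)]

end retr

end ThickPts

namespace ThickPts

set_option linter.unusedSectionVars false

variable {Ω : Type*} [MeasurableSpace Ω] {P : Measure Ω} [IsProbabilityMeasure P]
variable {d : ℕ}

/-- comparison constant between the sup norm and the Euclidean norm -/
def kap (d : ℕ) : ℝ :=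
  ‖((PiLp.continuousLinearEquiv 2 ℝ (fun _ : Fin d => ℝ)).symm :
    (Fin d → ℝ) →L[ℝ] EuclideanSpace ℝ (Fin d))‖

lemma kap_nonneg : 0 ≤ kap d := norm_nonneg _

lemma norm_toLp_le (w : Fin d → ℝ) : ‖(WithLp.toLp 2 w : EuclideanSpace ℝ (Fin d))‖ ≤ kap d * ‖w‖ :=
  ((PiLp.continuousLinearEquiv 2 ℝ (fun _ : Fin d => ℝ)).symm :
    (Fin d → ℝ) →L[ℝ] EuclideanSpace ℝ (Fin d)).le_opNorm w

lemma tendsto_toLp {α : Type*} {l : Filter α} {f : α → Fin d → ℝ} {x : EuclideanSpace ℝ (Fin d)}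
    (h : ∀ i, Tendsto (fun a => f a i) l (nhds (x i))) :
    Tendsto (fun a => (WithLp.toLp 2 (f a) : EuclideanSpace ℝ (Fin d))) l (nhds x) := by
  have h1 : Tendsto f l (nhds (WithLp.ofLp x)) := tendsto_pi_nhds.2 h
  exact ((PiLp.continuous_toLp 2 (fun _ : Fin d => ℝ)).tendsto (WithLp.ofLp x)).comp h1

section proc
variable {X : ℝ → EuclideanSpace ℝ (Fin d) → Ω → ℝ}

lemma gauss_one (hgauss : IsCenteredGaussianProcess P
      (fun p : (Set.Ioc (0:ℝ) 1) × EuclideanSpace ℝ (Fin d) => X p.1.1 p.2))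
    {ε : ℝ} (hε : ε ∈ Set.Ioc (0:ℝ) 1) (x : EuclideanSpace ℝ (Fin d)) :
    ∃ σ : NNReal, P.map (X ε x) = gaussianReal 0 σ := by
  obtain ⟨σ, h⟩ := hgauss 1 ![1] ![(⟨ε, hε⟩, x)]
  exact ⟨σ, by simpa using h⟩

lemma gauss_incr (hgauss : IsCenteredGaussianProcess P
      (fun p : (Set.Ioc (0:ℝ) 1) × EuclideanSpace ℝ (Fin d) => X p.1.1 p.2))
    {ε η : ℝ} (hε : ε ∈ Set.Ioc (0:ℝ) 1) (hη : η ∈ Set.Ioc (0:ℝ) 1)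
    (x y : EuclideanSpace ℝ (Fin d)) :
    ∃ σ : NNReal, P.map (fun ω => X ε x ω - X η y ω) = gaussianReal 0 σ := by
  obtain ⟨σ, h⟩ := hgauss 2 ![1, -1] ![(⟨ε, hε⟩, x), (⟨η, hη⟩, y)]
  refine ⟨σ, ?_⟩
  rw [← h]
  congr 1
  ext ω
  simp [Fin.sum_univ_two, sub_eq_add_neg]

lemma tail_fixed {R : ℝ} (hgauss : IsCenteredGaussianProcess P
      (fun p : (Set.Ioc (0:ℝ) 1) × EuclideanSpace ℝ (Fin d) => X p.1.1 p.2))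
    {C : ℝ} (hC : 0 < C)
    (hA : ∀ ε ∈ Set.Ioc (0:ℝ) 1, ∀ η ∈ Set.Ioc (0:ℝ) 1,
      ∀ x ∈ Metric.ball (0 : EuclideanSpace ℝ (Fin d)) R,
      ∀ y ∈ Metric.ball (0 : EuclideanSpace ℝ (Fin d)) R,
      ∫ ω, (X ε x ω - X η y ω) ^ 2 ∂P ≤ C * (‖x - y‖ + |η - ε|) / min η ε)
    {r : ℝ} (hr : 0 < r) (hrR : r < R) {ε : ℝ} (hε : ε ∈ Set.Ioc (0:ℝ) 1) (p : ℕ) :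
    TailBd P (fun u : Fin d → ℝ => X ε (retr r (WithLp.toLp 2 u))) p
      (2 * p.factorial * (2 * (C * (2 * kap d + 1) / ε)) ^ p) := by
  have hk := kap_nonneg (d := d)
  have hε0 := hε.1
  refine tailBd_of_var (by positivity) (fun u v => gauss_incr hgauss hε hε _ _) (fun u v => ?_) p
  have hb : ∀ x : EuclideanSpace ℝ (Fin d), retr r x ∈ Metric.ball 0 R := fun x => by
    rw [mem_ball_zero_iff]; exact (norm_retr_le hr x).trans_lt hrR
  refine (hA ε hε ε hε _ (hb _) _ (hb _)).trans ?_
  have h1 := norm_retr_sub_le hr (WithLp.toLp 2 u : EuclideanSpace ℝ (Fin d)) (WithLp.toLp 2 v)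
  have h2 := norm_toLp_le (u - v)
  rw [WithLp.toLp_sub] at h2
  simp only [sub_self, abs_zero, add_zero, min_self]
  rw [div_mul_eq_mul_div, mul_assoc]
  gcongr
  nlinarith [norm_nonneg (u - v)]

lemma clamp_mem {δ : ℝ} (hδ : 0 < δ) (hδ1 : δ ≤ 1) (t : ℝ) :
    max δ (min 1 t) ∈ Set.Ioc (0:ℝ) 1 :=
  ⟨lt_max_of_lt_left hδ, max_le hδ1 (min_le_left _ _)⟩

lemma tail_joint {R : ℝ} (hgauss : IsCenteredGaussianProcess P
      (fun p : (Set.Ioc (0:ℝ) 1) × EuclideanSpace ℝ (Fin d) => X p.1.1 p.2))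
    {C : ℝ} (hC : 0 < C)
    (hA : ∀ ε ∈ Set.Ioc (0:ℝ) 1, ∀ η ∈ Set.Ioc (0:ℝ) 1,
      ∀ x ∈ Metric.ball (0 : EuclideanSpace ℝ (Fin d)) R,
      ∀ y ∈ Metric.ball (0 : EuclideanSpace ℝ (Fin d)) R,
      ∫ ω, (X ε x ω - X η y ω) ^ 2 ∂P ≤ C * (‖x - y‖ + |η - ε|) / min η ε)
    {r : ℝ} (hr : 0 < r) (hrR : r < R) {δ : ℝ} (hδ : 0 < δ) (hδ1 : δ ≤ 1) (p : ℕ) :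
    TailBd P (fun u : Fin (d + 1) → ℝ =>
        X (max δ (min 1 (u 0))) (retr r (WithLp.toLp 2 (Fin.tail u)))) p
      (2 * p.factorial * (2 * (C * (2 * kap d + 1) / δ)) ^ p) := by
  have hk := kap_nonneg (d := d)
  refine tailBd_of_var (by positivity)
    (fun u v => gauss_incr hgauss (clamp_mem hδ hδ1 _) (clamp_mem hδ hδ1 _) _ _) (fun u v => ?_) p
  have hb : ∀ x : EuclideanSpace ℝ (Fin d), retr r x ∈ Metric.ball 0 R := fun x => by
    rw [mem_ball_zero_iff]; exact (norm_retr_le hr x).trans_lt hrR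
  refine (hA _ (clamp_mem hδ hδ1 _) _ (clamp_mem hδ hδ1 _) _ (hb _) _ (hb _)).trans ?_
  have h1 := norm_retr_sub_le hr (WithLp.toLp 2 (Fin.tail u) : EuclideanSpace ℝ (Fin d))
    (WithLp.toLp 2 (Fin.tail v))
  have h2 := norm_toLp_le (Fin.tail u - Fin.tail v)
  rw [WithLp.toLp_sub] at h2
  have h3 : ‖Fin.tail u - Fin.tail v‖ ≤ ‖u - v‖ := by
    rw [pi_norm_le_iff_of_nonneg (norm_nonneg _)]
    intro i
    exact norm_le_pi_norm (u - v) i.succ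
  have h4 : |max δ (min 1 (v 0)) - max δ (min 1 (u 0))| ≤ ‖u - v‖ := by
    have a1 := abs_max_sub_max_le_abs (min 1 (v 0)) (min 1 (u 0)) δ
    have a2 := abs_min_sub_min_le_max 1 (v 0) 1 (u 0)
    rw [sub_self, abs_zero, max_eq_right (abs_nonneg _)] at a2
    rw [max_comm δ, max_comm δ]
    refine a1.trans (a2.trans ?_)
    rw [abs_sub_comm]
    exact norm_le_pi_norm (u - v) 0
  have h5 : δ ≤ min (max δ (min 1 (v 0))) (max δ (min 1 (u 0))) :=
    le_min (le_max_left _ _) (le_max_left _ _)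
  rw [div_mul_eq_mul_div, mul_assoc]
  have h6 : kap d * ‖Fin.tail u - Fin.tail v‖ ≤ kap d * ‖u - v‖ := by gcongr
  gcongr
  linarith

/-- coordinates of a point of `ℝ × ℝᵈ` -/
def emb (q : ℝ × EuclideanSpace ℝ (Fin d)) : Fin (d + 1) → ℝ := Fin.cons q.1 (WithLp.ofLp q.2)

lemma emb_sub_le (q q' : ℝ × EuclideanSpace ℝ (Fin d)) : ‖emb q - emb q'‖ ≤ dist q q' := by
  rw [pi_norm_le_iff_of_nonneg dist_nonneg]
  intro i
  rw [dist_eq_norm]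
  refine Fin.cases ?_ (fun j => ?_) i
  · simpa [emb] using norm_fst_le (q - q')
  · have h1 := PiLp.norm_apply_le (q - q').2 j
    have h2 := h1.trans (norm_snd_le (q - q'))
    simpa [emb] using h2

/-- dyadic approximation from above -/
def apx (j : ℕ) (q : ℝ × EuclideanSpace ℝ (Fin d)) : ℝ × EuclideanSpace ℝ (Fin d) :=
  ((⌈q.1 * 2 ^ j⌉ : ℝ) / 2 ^ j, WithLp.toLp 2 (fun i => (⌈q.2 i * 2 ^ j⌉ : ℝ) / 2 ^ j))

lemma isDy_apx (j : ℕ) (q : ℝ × EuclideanSpace ℝ (Fin d)) : IsDy (emb (apx j q)) := by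
  refine ⟨j, fun i => ⌈emb q i * 2 ^ j⌉, fun i => ?_⟩
  refine Fin.cases ?_ (fun k => ?_) i <;> simp [emb, apx]

lemma tendsto_ceil (t : ℝ) : Tendsto (fun j : ℕ => (⌈t * 2 ^ j⌉ : ℝ) / 2 ^ j) atTop (nhds t) := by
  have h2 : Tendsto (fun j : ℕ => t + (1 / 2 : ℝ) ^ j) atTop (nhds t) := by
    simpa using (tendsto_pow_atTop_nhds_zero_of_lt_one (r := (1 / 2 : ℝ)) (by norm_num)
      (by norm_num)).const_add t
  refine tendsto_of_tendsto_of_tendsto_of_le_of_le tendsto_const_nhds h2 (fun j => ?_) (fun j => ?_)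
  · have : (0:ℝ) < 2 ^ j := by positivity
    rw [le_div_iff₀ this]; exact Int.le_ceil _
  · have : (0:ℝ) < 2 ^ j := by positivity
    simp only
    rw [div_le_iff₀ this, add_mul, ← mul_pow]
    have := (Int.ceil_lt_add_one (t * 2 ^ j)).le
    norm_num; linarith

lemma tendsto_apx (q : ℝ × EuclideanSpace ℝ (Fin d)) :
    Tendsto (fun j => apx j q) atTop (nhds q) := by
  rw [nhds_prod_eq]
  exact (tendsto_ceil q.1).prodMk (tendsto_toLp fun i => tendsto_ceil (q.2 i))

/-- the domain -/
def dom (d : ℕ) (R : ℝ) : Set (ℝ × EuclideanSpace ℝ (Fin d)) := Set.Ioc (0:ℝ) 1 ×ˢ Metric.ball 0 R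

/-- its dyadic points -/
def domDy (d : ℕ) (R : ℝ) : Set (ℝ × EuclideanSpace ℝ (Fin d)) := {q | q ∈ dom d R ∧ IsDy (emb q)}

lemma apx_mem {R : ℝ} {q : ℝ × EuclideanSpace ℝ (Fin d)} (hq : q ∈ dom d R) :
    ∀ᶠ j in atTop, apx j q ∈ domDy d R := by
  have h2 : Tendsto (fun j => (apx j q).2) atTop (nhds q.2) :=
    (continuous_snd.tendsto q).comp (tendsto_apx q)
  filter_upwards [h2.eventually (Metric.isOpen_ball.mem_nhds hq.2)] with j hj
  refine ⟨⟨⟨?_, ?_⟩, hj⟩, isDy_apx j q⟩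
  · have : (0:ℝ) < 2 ^ j := by positivity
    have h3 : 0 < ⌈q.1 * 2 ^ j⌉ := Int.ceil_pos.2 (mul_pos hq.1.1 this)
    have h4 : (0:ℝ) < ⌈q.1 * 2 ^ j⌉ := by exact_mod_cast h3
    simp only [apx]; positivity
  · have : (0:ℝ) < 2 ^ j := by positivity
    simp only [apx]
    rw [div_le_one this]
    have : ⌈q.1 * 2 ^ j⌉ ≤ (2 ^ j : ℤ) := by
      rw [Int.ceil_le]; push_cast
      exact mul_le_of_le_one_left this.le hq.1.2
    exact_mod_cast this

/-- almost surely the dyadic restriction has limits everywhere on the domain -/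
lemma exists_lim {R : ℝ} (hR : 0 < R) (hgauss : IsCenteredGaussianProcess P
      (fun p : (Set.Ioc (0:ℝ) 1) × EuclideanSpace ℝ (Fin d) => X p.1.1 p.2))
    {C : ℝ} (hC : 0 < C)
    (hA : ∀ ε ∈ Set.Ioc (0:ℝ) 1, ∀ η ∈ Set.Ioc (0:ℝ) 1,
      ∀ x ∈ Metric.ball (0 : EuclideanSpace ℝ (Fin d)) R,
      ∀ y ∈ Metric.ball (0 : EuclideanSpace ℝ (Fin d)) R,
      ∫ ω, (X ε x ω - X η y ω) ^ 2 ∂P ≤ C * (‖x - y‖ + |η - ε|) / min η ε) :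
    ∀ᵐ ω ∂P, ∀ q ∈ dom d R, ∃ y,
      Tendsto (fun q : ℝ × EuclideanSpace ℝ (Fin d) => X q.1 q.2 ω)
        (nhdsWithin q (domDy d R)) (nhds y) := by
  have hk := kap_nonneg (d := d)
  obtain ⟨A, hAR⟩ := exists_nat_ge (max 1 R)
  have hmain : ∀ k j : ℕ, ∀ᵐ ω ∂P, ∃ δ > 0, ∀ u v : Fin (d + 1) → ℝ, IsDy u → IsDy v →
      ‖u‖ ≤ A → ‖v‖ ≤ A → ‖u - v‖ < δ →
      |X (max (1 / (k + 2)) (min 1 (u 0)))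
          (retr (R * (1 - 1 / (k + 2))) (WithLp.toLp 2 (Fin.tail u))) ω
        - X (max (1 / (k + 2)) (min 1 (v 0)))
          (retr (R * (1 - 1 / (k + 2))) (WithLp.toLp 2 (Fin.tail v))) ω| ≤ 1 / ((j:ℝ) + 1) := by
    intro k j
    have hk2 : (0:ℝ) < k + 2 := by positivity
    have hk1 : (1:ℝ) / (k + 2) < 1 := by
      rw [div_lt_one hk2]; have : (0:ℝ) ≤ k := by positivity
      linarith
    have hk0 : (0:ℝ) < 1 / (k + 2) := by positivity
    exact uc (tail_joint hgauss hC hA (r := R * (1 - 1 / (k + 2))) (δ := 1 / (k + 2))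
      (mul_pos hR (by linarith)) (by nlinarith) hk0 hk1.le (6 * (Fintype.card (Fin (d + 1)) + 1)))
      (by positivity) le_rfl (by positivity) A
  filter_upwards [ae_all_iff.2 fun k => ae_all_iff.2 (hmain k)] with ω hω q hq
  have hne : (nhdsWithin q (domDy d R)).NeBot := by
    rw [← mem_closure_iff_nhdsWithin_neBot]
    exact mem_closure_of_tendsto (tendsto_apx q) (apx_mem hq)
  -- choose the region
  have hlim : Tendsto (fun k : ℕ => (1:ℝ) / (k + 2)) atTop (nhds 0) := by
    have := (tendsto_one_div_add_atTop_nhds_zero_nat (𝕜 := ℝ)).comp (tendsto_add_atTop_nat 1)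
    refine this.congr fun k => ?_
    simp only [Function.comp]; push_cast; ring_nf
  have hlim2 : Tendsto (fun k : ℕ => R * (1 - (1:ℝ) / (k + 2))) atTop (nhds R) := by
    simpa using (hlim.const_sub 1).const_mul R
  have hqR : ‖q.2‖ < R := mem_ball_zero_iff.1 hq.2
  obtain ⟨k, hk1, hk2⟩ := ((hlim.eventually_lt_const hq.1.1).and
    (hlim2.eventually_const_lt hqR)).exists
  set r := R * (1 - (1:ℝ) / (k + 2))
  set δ := (1:ℝ) / (k + 2)
  have hr : 0 < r := (norm_nonneg _).trans_lt hk2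
  let U : Set (ℝ × EuclideanSpace ℝ (Fin d)) := {q' | δ < q'.1 ∧ ‖q'.2‖ < r}
  have hU : U ∈ nhds q := by
    refine IsOpen.mem_nhds (?_ : IsOpen U) (show q ∈ U from ⟨hk1, hk2⟩)
    exact (isOpen_lt continuous_const continuous_fst).inter
      (isOpen_lt (continuous_norm.comp continuous_snd) continuous_const)
  have hval : ∀ q' ∈ domDy d R, q' ∈ U →
      X (max δ (min 1 (emb q' 0))) (retr r (WithLp.toLp 2 (Fin.tail (emb q')))) ω
        = X q'.1 q'.2 ω := by
    intro q' h1 h2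
    have e1 : max δ (min 1 (emb q' 0)) = q'.1 := by
      simp only [emb, Fin.cons_zero]
      rw [min_eq_right h1.1.1.2, max_eq_right h2.1.le]
    have e2 : (WithLp.toLp 2 (Fin.tail (emb q')) : EuclideanSpace ℝ (Fin d)) = q'.2 := by
      simp [emb]
    rw [e1, e2, retr_of_le hr h2.2.le]
  have hnorm : ∀ q' ∈ domDy d R, ‖emb q'‖ ≤ A := by
    intro q' h1
    have h2 := emb_sub_le q' 0
    have h0 : emb (0 : ℝ × EuclideanSpace ℝ (Fin d)) = 0 := by
      ext i; refine Fin.cases ?_ (fun j => ?_) i <;> simp [emb]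
    rw [h0, sub_zero, dist_zero_right] at h2
    refine h2.trans (le_trans ?_ hAR)
    rw [Prod.norm_def]
    apply max_le_max
    · rw [Real.norm_of_nonneg h1.1.1.1.le]; exact h1.1.1.2
    · exact (mem_ball_zero_iff.1 h1.1.2).le
  rw [← cauchy_map_iff_exists_tendsto, Metric.cauchy_iff]
  refine ⟨inferInstance, fun e he => ?_⟩
  obtain ⟨j, hj⟩ := exists_nat_one_div_lt he
  obtain ⟨η, hη, hcl⟩ := hω k j
  refine ⟨_, image_mem_map (inter_mem (inter_mem (mem_nhdsWithin_of_mem_nhds hU)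
    (mem_nhdsWithin_of_mem_nhds (Metric.ball_mem_nhds q (half_pos hη)))) self_mem_nhdsWithin), ?_⟩
  rintro _ ⟨q1, ⟨⟨hq1U, hq1b⟩, hq1⟩, rfl⟩ _ ⟨q2, ⟨⟨hq2U, hq2b⟩, hq2⟩, rfl⟩
  have h := hcl (emb q1) (emb q2) hq1.2 hq2.2 (hnorm q1 hq1) (hnorm q2 hq2) (by
    refine (emb_sub_le q1 q2).trans_lt ?_
    have := dist_triangle_right q1 q2 q
    rw [Metric.mem_ball] at hq1b hq2b
    linarith)
  rw [hval q1 hq1 hq1U, hval q2 hq2 hq2U] at h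
  rw [Real.dist_eq]
  exact h.trans_lt hj

/-- existence of the continuous modification -/
lemma exists_modif {R : ℝ} (hR : 0 < R) (hgauss : IsCenteredGaussianProcess P
      (fun p : (Set.Ioc (0:ℝ) 1) × EuclideanSpace ℝ (Fin d) => X p.1.1 p.2))
    {C : ℝ} (hC : 0 < C)
    (hA : ∀ ε ∈ Set.Ioc (0:ℝ) 1, ∀ η ∈ Set.Ioc (0:ℝ) 1,
      ∀ x ∈ Metric.ball (0 : EuclideanSpace ℝ (Fin d)) R,
      ∀ y ∈ Metric.ball (0 : EuclideanSpace ℝ (Fin d)) R,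
      ∫ ω, (X ε x ω - X η y ω) ^ 2 ∂P ≤ C * (‖x - y‖ + |η - ε|) / min η ε) :
    ∃ X' : ℝ → EuclideanSpace ℝ (Fin d) → Ω → ℝ,
      (∀ ε ∈ Set.Ioc (0:ℝ) 1, ∀ x : EuclideanSpace ℝ (Fin d),
        ∀ᵐ ω ∂P, X' ε x ω = X ε x ω) ∧
      (∀ᵐ ω ∂P, ContinuousOn (fun p : ℝ × EuclideanSpace ℝ (Fin d) => X' p.1 p.2 ω)
        (Set.Ioc (0:ℝ) 1 ×ˢ Metric.ball 0 R)) := by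
  classical
  have hlim := exists_lim hR hgauss hC hA
  have hcl : dom d R ⊆ closure (domDy d R) := fun q hq =>
    mem_closure_of_tendsto (tendsto_apx q) (apx_mem hq)
  let F : Ω → ℝ × EuclideanSpace ℝ (Fin d) → ℝ := fun ω q => X q.1 q.2 ω
  refine ⟨fun ε x ω => if (ε, x) ∈ dom d R then extendFrom (domDy d R) (F ω) (ε, x)
    else X ε x ω, ?_, ?_⟩
  · intro ε hε x
    by_cases hx : (ε, x) ∈ dom d R
    swap
    · simp [hx]
    simp only [hx, if_true]
    -- shifted sequence inside the domain
    obtain ⟨j0, hj0⟩ := eventually_atTop.1 (apx_mem hx)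
    let a : ℕ → ℝ × EuclideanSpace ℝ (Fin d) := fun j => apx (j + j0) (ε, x)
    have ha : ∀ j, a j ∈ domDy d R := fun j => hj0 _ (by omega)
    have hat : Tendsto a atTop (nhds (ε, x)) := (tendsto_apx (ε, x)).comp (tendsto_add_atTop_nat j0)
    have hmeas : ∀ j, AEStronglyMeasurable (fun ω => F ω (a j)) P := fun j => by
      obtain ⟨σ, hσ⟩ := gauss_one hgauss (ha j).1.1 (a j).2
      exact (gauss_aemeas hσ).aestronglyMeasurable
    have h1 : TendstoInMeasure P (fun j ω => F ω (a j)) atTop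
        (fun ω => extendFrom (domDy d R) (F ω) (ε, x)) := by
      apply tendstoInMeasure_of_tendsto_ae hmeas
      filter_upwards [hlim] with ω hω
      have := tendsto_extendFrom (f := F ω) (hω (ε, x) hx)
      refine this.comp (tendsto_nhdsWithin_iff.2 ⟨hat, Eventually.of_forall ha⟩)
    have h2 : TendstoInMeasure P (fun j ω => F ω (a j)) atTop (fun ω => X ε x ω) := by
      rw [tendstoInMeasure_iff_norm]
      intro t ht
      let s : ℕ → ℝ := fun j => C * (‖(a j).2 - x‖ + |ε - (a j).1|) / min ε (a j).1
      have hs : Tendsto s atTop (nhds 0) := by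
        have b1 : Tendsto (fun j => (a j).1) atTop (nhds ε) := (continuous_fst.tendsto _).comp hat
        have b2 : Tendsto (fun j => (a j).2) atTop (nhds x) := (continuous_snd.tendsto _).comp hat
        have b3 : Tendsto s atTop (nhds (C * (‖x - x‖ + |ε - ε|) / min ε ε)) := by
          refine Tendsto.div (Tendsto.const_mul C ?_) (tendsto_const_nhds.min b1) ?_
          · exact (b2.sub_const x).norm.add (b1.const_sub ε).abs
          · rw [min_self]; exact hε.1.ne'
        simpa using b3
      have hs0 : ∀ j, 0 ≤ s j := fun j => by
        have := (ha j).1.1.1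
        have := hε.1
        have : 0 < min ε (a j).1 := lt_min ‹_› ‹_›
        positivity
      have hbd : ∀ j : ℕ, P {ω | t ≤ ‖F ω (a j) - X ε x ω‖} ≤
          ENNReal.ofReal (2 * (Nat.factorial 1) *
            (2 * (s j + 1 / ((j:ℝ) + 1)) / t ^ 2) ^ 1) := by
        intro j
        obtain ⟨σ, hσ⟩ := gauss_incr hgauss (ha j).1.1 hε (a j).2 x
        have hj : (0:ℝ) < 1 / ((j:ℝ) + 1) := by positivity
        refine gauss_poly_tail hσ (s := s j + 1 / ((j:ℝ) + 1)) (by linarith [hs0 j]) ?_ ht 1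
        have := hA _ (ha j).1.1 ε hε _ (ha j).1.2 x hx.2
        linarith
      have hz : Tendsto (fun j : ℕ => ENNReal.ofReal (2 * (Nat.factorial 1) *
            (2 * (s j + 1 / ((j:ℝ) + 1)) / t ^ 2) ^ 1)) atTop (nhds 0) := by
        have := (((hs.add (tendsto_one_div_add_atTop_nhds_zero_nat (𝕜 := ℝ))).const_mul 2).div_const
          (t ^ 2)).pow 1 |>.const_mul (2 * ((Nat.factorial 1 : ℕ) : ℝ))
        have := ENNReal.tendsto_ofReal this
        simpa using this
      exact tendsto_of_tendsto_of_tendsto_of_le_of_le tendsto_const_nhds hz (fun _ => zero_le) hbd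
    exact tendstoInMeasure_ae_unique h1 h2
  · filter_upwards [hlim] with ω hω
    refine (continuousOn_extendFrom (f := F ω) hcl hω).congr ?_
    intro q hq
    have : q ∈ dom d R := hq
    simp [this]

end proc

end ThickPts

namespace ThickPts

set_option linter.unusedSectionVars false

variable {Ω : Type*} [MeasurableSpace Ω] {P : Measure Ω} [IsProbabilityMeasure P]
variable {d : ℕ} {X : ℝ → EuclideanSpace ℝ (Fin d) → Ω → ℝ}

lemma exp_neg_mem (N : ℕ) : Real.exp (-(N:ℝ)) ∈ Set.Ioc (0:ℝ) 1 :=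
  ⟨Real.exp_pos _, Real.exp_le_one_iff.2 (by simp)⟩

lemma tendsto_exp_decay {e : ℝ} (he : 0 < e) :
    Tendsto (fun N : ℕ => Real.exp (-(e * N))) atTop (nhds 0) := by
  apply Real.tendsto_exp_neg_atTop_nhds_zero.comp
  exact tendsto_natCast_atTop_atTop.const_mul_atTop he

lemma tendsto_exp_neg_nat :
    Tendsto (fun N : ℕ => Real.exp (-(N:ℝ))) atTop (nhdsWithin 0 (Set.Ioi 0)) := by
  refine tendsto_nhdsWithin_iff.2 ⟨?_, Eventually.of_forall fun N => Real.exp_pos _⟩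
  exact Real.tendsto_exp_neg_atTop_nhds_zero.comp tendsto_natCast_atTop_atTop

lemma G_lim {G : ℝ → ℝ}
    (hGlim : Tendsto (fun ε => G ε / Real.log (1 / ε)) (nhdsWithin 0 (Set.Ioi 0)) (nhds 1)) :
    Tendsto (fun N : ℕ => G (Real.exp (-(N:ℝ))) / N) atTop (nhds 1) := by
  refine (hGlim.comp tendsto_exp_neg_nat).congr fun N => ?_
  simp

/-- approximating a point from inside its cell -/
lemma cell_approx {h : ℝ} (hh : 0 < h) (x : EuclideanSpace ℝ (Fin d)) :
    ∃ (z : Fin d → ℤ) (w : ℕ → Fin d → ℕ), (∀ i, (|z i| : ℝ) ≤ ‖x‖ / h + 1) ∧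
      (∀ k i, w k i < 2 ^ k) ∧
      Tendsto (fun k => (WithLp.toLp 2 (gr h z + h • dy k (w k)) : EuclideanSpace ℝ (Fin d)))
        atTop (nhds x) := by
  refine ⟨fun i => ⌊x i / h⌋, fun k i => ⌊Int.fract (x i / h) * 2 ^ k⌋₊, ?_, ?_, ?_⟩
  · intro i
    have h1 : |x i| ≤ ‖x‖ := PiLp.norm_apply_le x i
    have h2 : |x i / h| ≤ ‖x‖ / h := by rw [abs_div, abs_of_pos hh]; gcongr
    have h3 := Int.floor_le (x i / h)
    have h4 := Int.lt_floor_add_one (x i / h)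
    have h5 := abs_le.1 h2
    exact abs_le.2 ⟨by linarith, by linarith⟩
  · intro k i
    have h0 := Int.fract_nonneg (x i / h)
    rw [Nat.floor_lt (by positivity)]
    push_cast
    exact mul_lt_of_lt_one_left (by positivity) (Int.fract_lt_one _)
  · apply tendsto_toLp
    intro i
    have h1 : Tendsto (fun k : ℕ => (2:ℝ) ^ k) atTop atTop :=
      tendsto_pow_atTop_atTop_of_one_lt (by norm_num)
    have h2 := (tendsto_nat_floor_mul_div_atTop (Int.fract_nonneg (x i / h))).comp h1
    have h3 := (h2.const_mul h).const_add (h * (⌊x i / h⌋ : ℝ))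
    have e : h * (⌊x i / h⌋ : ℝ) + h * Int.fract (x i / h) = x i := by
      rw [← mul_add, Int.floor_add_fract]; field_simp
    rw [e] at h3
    exact h3

lemma thick_bound {R : ℝ} (hgauss : IsCenteredGaussianProcess P
      (fun p : (Set.Ioc (0:ℝ) 1) × EuclideanSpace ℝ (Fin d) => X p.1.1 p.2))
    {C : ℝ} (hC : 0 < C)
    (hA : ∀ ε ∈ Set.Ioc (0:ℝ) 1, ∀ η ∈ Set.Ioc (0:ℝ) 1,
      ∀ x ∈ Metric.ball (0 : EuclideanSpace ℝ (Fin d)) R,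
      ∀ y ∈ Metric.ball (0 : EuclideanSpace ℝ (Fin d)) R,
      ∫ ω, (X ε x ω - X η y ω) ^ 2 ∂P ≤ C * (‖x - y‖ + |η - ε|) / min η ε)
    {G : ℝ → ℝ}
    (hGvar : ∀ ε ∈ Set.Ioc (0:ℝ) 1, ∀ x : EuclideanSpace ℝ (Fin d),
      ∫ ω, (X ε x ω) ^ 2 ∂P = G ε)
    (hGlim : Tendsto (fun ε => G ε / Real.log (1 / ε)) (nhdsWithin 0 (Set.Ioi 0)) (nhds 1))
    {X' : ℝ → EuclideanSpace ℝ (Fin d) → Ω → ℝ}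
    (hmod : ∀ ε ∈ Set.Ioc (0:ℝ) 1, ∀ x : EuclideanSpace ℝ (Fin d),
        ∀ᵐ ω ∂P, X' ε x ω = X ε x ω)
    (hcont : ∀ᵐ ω ∂P, ContinuousOn (fun p : ℝ × EuclideanSpace ℝ (Fin d) => X' p.1 p.2 ω)
        (Set.Ioc (0:ℝ) 1 ×ˢ Metric.ball 0 R))
    (hd : 1 ≤ d) {b : ℝ} (hb : Real.sqrt (2 * d) < b) {r : ℝ} (hr : 0 < r) (hrR : r < R) :
    ∀ᵐ ω ∂P, ∃ᶠ N : ℕ in atTop, ∀ x ∈ Metric.ball (0 : EuclideanSpace ℝ (Fin d)) r,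
      X' (Real.exp (-(N:ℝ))) x ω ≤ b * N + 1 := by
  classical
  have hk := kap_nonneg (d := d)
  have hd0 : (0:ℝ) < d := by exact_mod_cast hd
  have hsq : 0 < Real.sqrt (2 * d) := Real.sqrt_pos.2 (by positivity)
  have hb0 : 0 < b := hsq.trans hb
  obtain ⟨q, hq1, hq2⟩ := exists_between ((one_lt_div hsq).2 hb)
  rw [lt_div_iff₀ hsq] at hq2
  have hq0 : 0 < q := by linarith
  have hq3 : q ^ 2 * (2 * d) < b ^ 2 := by
    have h1 : (q * Real.sqrt (2 * d)) ^ 2 < b ^ 2 := by gcongr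
    rwa [mul_pow, Real.sq_sqrt (by positivity)] at h1
  -- exponents
  have he1 : 0 < b ^ 2 / (2 * q) - q * d := by
    rw [sub_pos, lt_div_iff₀ (by positivity)]; nlinarith
  obtain ⟨p0, hp0⟩ := exists_nat_gt (q * d / (q - 1))
  set p := max p0 (6 * (Fintype.card (Fin d) + 1))
  have hp : 6 * (Fintype.card (Fin d) + 1) ≤ p := le_max_right _ _
  have hpp : q * d / (q - 1) < p := hp0.trans_le (by exact_mod_cast le_max_left _ _)
  have he2 : 0 < (q - 1) * p - q * d := by
    rw [div_lt_iff₀ (by linarith)] at hpp; linarith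
  have hKC : 0 ≤ KC d p := by unfold KC; positivity
  let h : ℕ → ℝ := fun N => Real.exp (-(q * N))
  have hh : ∀ N, 0 < h N := fun N => Real.exp_pos _
  let m : ℕ → ℕ := fun N => ⌈r / h N⌉₊ + 1
  have hm : ∀ N, (2 * (m N : ℝ) + 1) ^ d ≤ (2 * r + 5) ^ d * Real.exp (q * d * N) := by
    intro N
    have h1 : (1:ℝ) ≤ Real.exp (q * N) := Real.one_le_exp (by positivity)
    have h2 : r / h N = r * Real.exp (q * N) := by
      simp only [h]; rw [Real.exp_neg, div_inv_eq_mul]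
    have h3 : (⌈r / h N⌉₊ : ℝ) < r / h N + 1 := Nat.ceil_lt_add_one (by positivity)
    have h4 : 2 * (m N : ℝ) + 1 ≤ (2 * r + 5) * Real.exp (q * N) := by
      simp only [m]; push_cast; rw [h2] at *; nlinarith
    calc (2 * (m N : ℝ) + 1) ^ d ≤ ((2 * r + 5) * Real.exp (q * N)) ^ d := by gcongr
      _ = _ := by rw [mul_pow, ← Real.exp_nat_mul]; congr 2; ring
  let Y : ℕ → (Fin d → ℝ) → Ω → ℝ :=
    fun N u => X (Real.exp (-(N:ℝ))) (retr r (WithLp.toLp 2 u))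
  let B1 : ℕ → Set Ω := fun N => {ω | ∃ (z : Fin d → ℤ) (k : ℕ) (w : Fin d → ℕ),
    (∀ i, |z i| ≤ m N) ∧ (∀ i, w i < 2 ^ k) ∧
      1 < |Y N (gr (h N) z + h N • dy k w) ω - Y N (gr (h N) z) ω|}
  let B2 : ℕ → Set Ω := fun N => ⋃ z ∈ Fintype.piFinset (fun _ : Fin d =>
      Finset.Icc (-(m N:ℤ)) (m N)), {ω | b * N ≤ Y N (gr (h N) z) ω}
  let c1 : ℝ := (2 * r + 5) ^ d
  let c2 : ℝ := (2 * r + 5) ^ d * (KC d p * (2 * p.factorial * (2 * (C * (2 * kap d + 1))) ^ p))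
  let f : ℕ → ℝ := fun N => c1 * Real.exp (-((b ^ 2 / (2 * q) - q * d) * N))
    + c2 * Real.exp (-(((q - 1) * p - q * d) * N))
  have hf : Tendsto f atTop (nhds 0) := by
    simpa using ((tendsto_exp_decay he1).const_mul c1).add ((tendsto_exp_decay he2).const_mul c2)
  have hB1 : ∀ N, P (B1 N) ≤ ENNReal.ofReal (c2 * Real.exp (-(((q - 1) * p - q * d) * N))) := by
    intro N
    have ht := tail_fixed hgauss hC hA hr hrR (exp_neg_mem N) p
    refine (cells ht (by have := Real.exp_pos (-(N:ℝ)); positivity) hp one_pos (h N) (hh N)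
      (m N)).trans (ENNReal.ofReal_le_ofReal ?_)
    rw [Fintype.card_fin, one_pow, one_pow, div_one]
    have e1 : (2 * (C * (2 * kap d + 1) / Real.exp (-(N:ℝ)))) ^ p
        = (2 * (C * (2 * kap d + 1))) ^ p * Real.exp (p * N) := by
      rw [Real.exp_nat_mul, ← mul_pow, Real.exp_neg]; congr 1; field_simp
    have e2 : h N ^ p = Real.exp (-(q * p * N)) := by
      simp only [h]; rw [← Real.exp_nat_mul]; congr 1; ring
    rw [e1, e2]
    calc _ ≤ ((2 * r + 5) ^ d * Real.exp (q * d * N)) * (KC d p * (2 * p.factorial *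
          ((2 * (C * (2 * kap d + 1))) ^ p * Real.exp (p * N)) * Real.exp (-(q * p * N)))) :=
          mul_le_mul_of_nonneg_right (hm N) (by positivity)
      _ = c2 * (Real.exp (q * d * N) * Real.exp (p * N) * Real.exp (-(q * p * N))) := by
          simp only [c2]; ring
      _ = _ := by rw [← Real.exp_add, ← Real.exp_add]; congr 2; ring
      _ ≤ _ := le_rfl
  have hB2 : ∀ᶠ N in atTop,
      P (B2 N) ≤ ENNReal.ofReal (c1 * Real.exp (-((b ^ 2 / (2 * q) - q * d) * N))) := by
    filter_upwards [(G_lim hGlim).eventually_lt_const hq1, eventually_ge_atTop 1] with N hN hN1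
    have hN0 : (0:ℝ) < N := by exact_mod_cast hN1
    rw [div_lt_iff₀ hN0] at hN
    refine (measure_biUnion_finset_le _ _).trans ?_
    have h1 : ∀ z ∈ Fintype.piFinset (fun _ : Fin d => Finset.Icc (-(m N:ℤ)) (m N)),
        P {ω | b * N ≤ Y N (gr (h N) z) ω} ≤
          ENNReal.ofReal (Real.exp (-(b ^ 2 / (2 * q) * N))) := by
      intro z _
      obtain ⟨σ, hσ⟩ := gauss_one hgauss (exp_neg_mem N)
        (retr r (WithLp.toLp 2 (gr (h N) z) : EuclideanSpace ℝ (Fin d)))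
      refine (gauss_tail hσ (s := q * N) (t := b * N) (by positivity) ?_ (by positivity)).trans_eq ?_
      · rw [hGvar _ (exp_neg_mem N)]; exact hN.le
      · congr 3; field_simp
    refine (Finset.sum_le_sum h1).trans ?_
    rw [Finset.sum_const, nsmul_eq_mul, ← ENNReal.ofReal_natCast,
      ← ENNReal.ofReal_mul (by positivity), grid_card, Fintype.card_fin]
    apply ENNReal.ofReal_le_ofReal
    calc _ ≤ ((2 * r + 5) ^ d * Real.exp (q * d * N)) * Real.exp (-(b ^ 2 / (2 * q) * N)) :=
          mul_le_mul_of_nonneg_right (hm N) (by positivity)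
      _ = _ := by rw [mul_assoc, ← Real.exp_add]; congr 2; ring
  have hB : ∀ᶠ N in atTop, P (B1 N ∪ B2 N) ≤ ENNReal.ofReal (f N) := by
    filter_upwards [hB2] with N hN
    refine (measure_union_le _ _).trans ((add_le_add (hB1 N) hN).trans_eq ?_)
    have : 0 ≤ c2 := by positivity
    rw [← ENNReal.ofReal_add (by positivity) (by positivity), add_comm]
  have hgrid : ∀ᵐ ω ∂P, ∀ (N : ℕ) (z : Fin d → ℤ) (k : ℕ) (w : Fin d → ℕ),
      X' (Real.exp (-(N:ℝ))) (WithLp.toLp 2 (gr (h N) z + h N • dy k w)) ω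
        = X (Real.exp (-(N:ℝ))) (WithLp.toLp 2 (gr (h N) z + h N • dy k w)) ω := by
    rw [ae_all_iff]; intro N
    rw [ae_all_iff]; intro z
    rw [ae_all_iff]; intro k
    rw [ae_all_iff]; intro w
    exact hmod _ (exp_neg_mem N) _
  filter_upwards [ae_frequently_of_tendsto hf hB, hgrid, hcont] with ω hω hgr hct
  refine hω.mono fun N hN x hx => ?_
  rw [Set.mem_union, not_or] at hN
  obtain ⟨hN1, hN2⟩ := hN
  have hxr : ‖x‖ < r := mem_ball_zero_iff.1 hx
  obtain ⟨z, w, hz, hw, hlim⟩ := cell_approx (hh N) x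
  have hzm : ∀ i, |z i| ≤ m N := by
    intro i
    have h1 := hz i
    have h2 : ‖x‖ / h N ≤ r / h N := by have := hh N; gcongr
    have h3 := Nat.le_ceil (r / h N)
    have h4 : ((|z i| : ℤ) : ℝ) ≤ ((m N : ℕ) : ℝ) := by
      simp only [m]; push_cast; linarith
    exact_mod_cast h4
  have hball : ∀ᶠ k in atTop, (WithLp.toLp 2 (gr (h N) z + h N • dy k (w k)) :
      EuclideanSpace ℝ (Fin d)) ∈ Metric.ball 0 r :=
    hlim.eventually (Metric.isOpen_ball.mem_nhds hx)
  have hsub : Metric.ball (0 : EuclideanSpace ℝ (Fin d)) r ⊆ Metric.ball 0 R :=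
    Metric.ball_subset_ball hrR.le
  have hval : Tendsto (fun k => X' (Real.exp (-(N:ℝ)))
      (WithLp.toLp 2 (gr (h N) z + h N • dy k (w k))) ω) atTop
      (nhds (X' (Real.exp (-(N:ℝ))) x ω)) := by
    have h1 := hct (Real.exp (-(N:ℝ)), x) ⟨exp_neg_mem N, hsub hx⟩
    refine h1.tendsto.comp (f := fun k => (Real.exp (-(N:ℝ)),
      (WithLp.toLp 2 (gr (h N) z + h N • dy k (w k)) : EuclideanSpace ℝ (Fin d))))
      (tendsto_nhdsWithin_iff.2 ⟨?_, ?_⟩)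
    · rw [nhds_prod_eq]; exact tendsto_const_nhds.prodMk hlim
    · filter_upwards [hball] with k hk
      exact ⟨exp_neg_mem N, hsub hk⟩
  refine le_of_tendsto hval ?_
  filter_upwards [hball] with k hk
  rw [hgr]
  have e : X (Real.exp (-(N:ℝ))) (WithLp.toLp 2 (gr (h N) z + h N • dy k (w k))) ω
      = Y N (gr (h N) z + h N • dy k (w k)) ω := by
    simp only [Y]
    rw [retr_of_le hr (mem_ball_zero_iff.1 hk).le]
  rw [e]
  have h1 : |Y N (gr (h N) z + h N • dy k (w k)) ω - Y N (gr (h N) z) ω| ≤ 1 := by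
    by_contra hcon
    exact hN1 ⟨z, k, w k, hzm, hw k, not_le.1 hcon⟩
  have h2 : Y N (gr (h N) z) ω < b * N := by
    by_contra hcon
    refine hN2 (Set.mem_iUnion₂.2 ⟨z, ?_, not_lt.1 hcon⟩)
    simp only [Fintype.mem_piFinset, Finset.mem_Icc]
    exact fun i => abs_le.1 (hzm i)
  have := (abs_le.1 h1).2
  linarith

end ThickPts

theorem thick_points_empty_above_sqrt_two_d
    (d : ℕ) (hd : 2 ≤ d) (R : ℝ) (hR : 0 < R)
    {Ω : Type*} [MeasurableSpace Ω] (P : Measure Ω) [IsProbabilityMeasure P]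
    (X : ℝ → EuclideanSpace ℝ (Fin d) → Ω → ℝ)
    (hgauss : IsCenteredGaussianProcess P
      (fun p : (Set.Ioc (0:ℝ) 1) × EuclideanSpace ℝ (Fin d) => X p.1.1 p.2))
    -- (A) : Hölder-type bound on increments
    (C : ℝ) (hC : 0 < C)
    (hA : ∀ ε ∈ Set.Ioc (0:ℝ) 1, ∀ η ∈ Set.Ioc (0:ℝ) 1,
      ∀ x ∈ Metric.ball (0 : EuclideanSpace ℝ (Fin d)) R,
      ∀ y ∈ Metric.ball (0 : EuclideanSpace ℝ (Fin d)) R,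
      ∫ ω, (X ε x ω - X η y ω) ^ 2 ∂P ≤ C * (‖x - y‖ + |η - ε|) / min η ε)
    -- (B) : the variance does not depend on x and is asymptotically log(1/ε)
    (G : ℝ → ℝ)
    (hGvar : ∀ ε ∈ Set.Ioc (0:ℝ) 1, ∀ x : EuclideanSpace ℝ (Fin d),
      ∫ ω, (X ε x ω) ^ 2 ∂P = G ε)
    (hGlim : Tendsto (fun ε => G ε / Real.log (1 / ε)) (nhdsWithin 0 (Set.Ioi 0)) (nhds 1)) :
    ∃ X' : ℝ → EuclideanSpace ℝ (Fin d) → Ω → ℝ,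
      -- X' is a modification of X
      (∀ ε ∈ Set.Ioc (0:ℝ) 1, ∀ x : EuclideanSpace ℝ (Fin d),
        ∀ᵐ ω ∂P, X' ε x ω = X ε x ω) ∧
      -- X' is jointly continuous in (ε, x) on (0,1] × B(0,R)
      (∀ᵐ ω ∂P, ContinuousOn (fun p : ℝ × EuclideanSpace ℝ (Fin d) => X' p.1 p.2 ω)
        (Set.Ioc (0:ℝ) 1 ×ˢ Metric.ball 0 R)) ∧
      -- for a > √(2d) the set of thick points is almost surely empty
      (∀ a : ℝ, Real.sqrt (2 * d) < a →
        ∀ᵐ ω ∂P,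
          {x : EuclideanSpace ℝ (Fin d) | x ∈ Metric.ball 0 R ∧
              ∃ L : ℝ, a ≤ L ∧
                Tendsto (fun ε => X' ε x ω / G ε) (nhdsWithin 0 (Set.Ioi 0)) (nhds L)}
            = ∅) := by
  obtain ⟨X', hmod, hcont⟩ := ThickPts.exists_modif hR hgauss hC hA
  refine ⟨X', hmod, hcont, fun a ha => ?_⟩
  obtain ⟨b, hb1, hb2⟩ := exists_between ha
  have hGN := ThickPts.G_lim hGlim
  have hall : ∀ᵐ ω ∂P, ∀ j : ℕ, ∃ᶠ N : ℕ in atTop,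
      ∀ x ∈ Metric.ball (0 : EuclideanSpace ℝ (Fin d)) (R * (1 - 1 / ((j:ℝ) + 2))),
      X' (Real.exp (-(N:ℝ))) x ω ≤ b * N + 1 := by
    rw [ae_all_iff]
    intro j
    have hj2 : (0:ℝ) < (j:ℝ) + 2 := by positivity
    have hj0 : (0:ℝ) < 1 / ((j:ℝ) + 2) := by positivity
    have hj1 : 1 / ((j:ℝ) + 2) < 1 := by
      rw [div_lt_one hj2]; have : (0:ℝ) ≤ j := by positivity
      linarith
    exact ThickPts.thick_bound hgauss hC hA hGvar hGlim hmod hcont (by omega) hb1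
      (mul_pos hR (by linarith)) (by nlinarith)
  filter_upwards [hall] with ω hω
  rw [Set.eq_empty_iff_forall_notMem]
  rintro x ⟨hx, L, haL, hL⟩
  have hxR : ‖x‖ < R := mem_ball_zero_iff.1 hx
  have hlim : Tendsto (fun k : ℕ => (1:ℝ) / (k + 2)) atTop (nhds 0) := by
    have := (tendsto_one_div_add_atTop_nhds_zero_nat (𝕜 := ℝ)).comp (tendsto_add_atTop_nat 1)
    refine this.congr fun k => ?_
    simp only [Function.comp]; push_cast; ring_nf
  have hlim2 : Tendsto (fun k : ℕ => R * (1 - (1:ℝ) / (k + 2))) atTop (nhds R) := by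
    simpa using (hlim.const_sub 1).const_mul R
  obtain ⟨j, hj⟩ := (hlim2.eventually_const_lt hxR).exists
  have h1 := hL.comp ThickPts.tendsto_exp_neg_nat
  have h2 : Tendsto (fun N : ℕ => (b + 1 / (N:ℝ)) / (G (Real.exp (-(N:ℝ))) / N)) atTop
      (nhds b) := by
    have := (tendsto_one_div_atTop_nhds_zero_nat (𝕜 := ℝ)).const_add b |>.div hGN one_ne_zero
    rw [add_zero, div_one] at this
    exact this
  have hlt : b < L := hb2.trans_le haL
  have hev := h2.eventually_lt h1 hlt
  have hpos := hGN.eventually_const_lt (zero_lt_one)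
  obtain ⟨N, hN, hev, hpos, hN1⟩ :=
    ((hω j).and_eventually (hev.and (hpos.and (eventually_ge_atTop 1)))).exists
  have hN0 : (0:ℝ) < N := by exact_mod_cast hN1
  have hG0 : 0 < G (Real.exp (-(N:ℝ))) := by
    have := mul_pos hpos hN0
    rwa [div_mul_cancel₀ _ hN0.ne'] at this
  have h3 := hN x (mem_ball_zero_iff.2 hj)
  have h4 : X' (Real.exp (-(N:ℝ))) x ω / G (Real.exp (-(N:ℝ)))
      ≤ (b * N + 1) / G (Real.exp (-(N:ℝ))) := by gcongr
  have h5 : (b + 1 / (N:ℝ)) / (G (Real.exp (-(N:ℝ))) / N) = (b * N + 1) / G (Real.exp (-(N:ℝ))) := by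
    field_simp
  rw [h5] at hev
  exact absurd hev (not_lt.2 h4)
end
end
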